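/- arXiv:2002.12850 — 3 statements merged into one kernel-verified Lean document; each statement's English description precedes it below -/
import Mathlib

section
/- In the abstract framework (case Σ = ℝⁿ), let k ≥ m ≥ 1 be integers, t > 0, and let x⁽ᵏ⁻ᵐ⁾, …, x⁽ᵏ⁾ ∈ U \ {x*}, with r⁽ᵏ⁻ᵐ⁺ⁱ⁾ = f(x⁽ᵏ⁻ᵐ⁺ⁱ⁾) for i = 0, …, m. For ℓ ∈ {1, …, m}, let d_ℓ = dist₂(r⁽ᵏ⁻ᵐ⁺ℓ⁾, Aff{r⁽ᵏ⁻ᵐ⁾, …, r⁽ᵏ⁻ᵐ⁺ℓ⁻¹⁾}), and assume d_i ≥ t · max_{j ∈ {i,…,m}} ‖r⁽ᵏ⁻ᵐ⁺ʲ⁾‖₂ for every i ∈ {1, …, m}; let c̃ ∈ ℝ^{m+1} be the unique vector with Σ c̃_i = 1 minimizing ‖Σ_{i=0}^{m} c̃_i r⁽ᵏ⁻ᵐ⁺ⁱ⁾‖₂, and set 𝒜 = Aff{r⁽ᵏ⁻ᵐ⁾, …, r⁽ᵏ⁾}. Assume in addition that x̃ = Σ_{i=0}^{m} c̃_i x⁽ᵏ⁻ᵐ⁺ⁱ⁾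 ∈ U, g(x̃) ∈ U and x⁽ᵏ⁺¹⁾ := Σ_{i=0}^{m} c̃_i g(x⁽ᵏ⁻ᵐ⁺ⁱ⁾) ∈ U (version A), and set r⁽ᵏ⁺¹⁾ = f(x⁽ᵏ⁺¹⁾). Then there exists a positive constant κ, depending only on f, g, x*, U, σ, K, L, L′ and p (not on m, t or the chosen points), such that ‖r⁽ᵏ⁺¹⁾‖₂ ≤ K · dist₂(0, 𝒜) + κ(1 + t^{−2m}) · max_{i ∈ {0,…,m}} ‖r⁽ᵏ⁻ᵐ⁺ⁱ⁾‖₂², and (1 − K)‖r⁽ᵏ⁺¹⁾‖₂ ≤ K · dist₂(r⁽ᵏ⁺¹⁾, 𝒜) + κ(1 + t^{−2m}) · max_{i ∈ {0,…,m}} ‖r⁽ᵏ⁻ᵐ⁺ⁱ⁾‖₂². -/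
/-- The affine span `Aff{r⁽⁰⁾, …, r⁽ℓ⁾} = {Σ_{i=0}^{ℓ} cᵢ r⁽ⁱ⁾ : Σ cᵢ = 1}`. -/
noncomputable def affSpan {P : ℕ} (r : ℕ → EuclideanSpace ℝ (Fin P)) (ℓ : ℕ) :
    Set (EuclideanSpace ℝ (Fin P)) :=
  {y | ∃ c : ℕ → ℝ, (∑ i ∈ Finset.range (ℓ + 1), c i) = 1 ∧
    y = ∑ i ∈ Finset.range (ℓ + 1), c i • r i}

lemma coef_of_mem_span {P : ℕ} (r : ℕ → EuclideanSpace ℝ (Fin P)) (l : ℕ)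
    (y : EuclideanSpace ℝ (Fin P))
    (hy : y - r 0 ∈ Submodule.span ℝ ((fun i => r i - r 0) '' (Finset.range (l + 1) : Set ℕ))) :
    ∃ c : ℕ → ℝ, (∑ i ∈ Finset.range (l + 1), c i) = 1 ∧
      y = ∑ i ∈ Finset.range (l + 1), c i • r i := by
  rw [Submodule.mem_span_image_finset_iff_exists_fun] at hy
  obtain ⟨e0, he0⟩ := hy
  obtain ⟨e, he⟩ : ∃ e : ℕ → ℝ, ∑ i ∈ Finset.range (l + 1), e i • (r i - r 0) = y - r 0 := by
    refine ⟨fun i => if h : i ∈ Finset.range (l + 1) then e0 ⟨i, h⟩ else 0, ?_⟩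
    rw [← he0, ← Finset.sum_coe_sort]
    refine Finset.sum_congr rfl fun i _ => ?_
    simp only [i.2, dif_pos]
  refine ⟨fun i => e i + if i = 0 then 1 - ∑ j ∈ Finset.range (l + 1), e j else 0, ?_, ?_⟩
  · rw [Finset.sum_add_distrib, Finset.sum_ite_eq' (Finset.range (l + 1)) 0]
    simp
  · simp only [add_smul, Finset.sum_add_distrib, ite_smul, zero_smul]
    rw [Finset.sum_ite_eq' (Finset.range (l + 1)) 0]
    simp only [smul_sub, Finset.sum_sub_distrib, ← Finset.sum_smul] at he
    simp only [Finset.mem_range, Nat.succ_pos, if_true, sub_smul, one_smul]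
    have he2 := eq_add_of_sub_eq he.symm
    rw [he2]
    abel

lemma exists_proj {P : ℕ} (r : ℕ → EuclideanSpace ℝ (Fin P)) (l : ℕ)
    (y : EuclideanSpace ℝ (Fin P)) :
    ∃ b : ℕ → ℝ, (∑ i ∈ Finset.range (l + 1), b i) = 1 ∧
      ∀ c : ℕ → ℝ, (∑ i ∈ Finset.range (l + 1), c i) = 0 →
        inner ℝ (y - ∑ i ∈ Finset.range (l + 1), b i • r i)
          (∑ i ∈ Finset.range (l + 1), c i • r i) = 0 := by
  set D := Submodule.span ℝ ((fun i => r i - r 0) '' (Finset.range (l + 1) : Set ℕ)) with hD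
  obtain ⟨b, hb, hb2⟩ := coef_of_mem_span r l (r 0 + D.starProjection (y - r 0)) (by
    rw [add_sub_cancel_left]; exact Submodule.starProjection_apply_mem _ _)
  refine ⟨b, hb, fun c hc => ?_⟩
  have h1 : ∑ i ∈ Finset.range (l + 1), c i • r i ∈ D := by
    have : ∑ i ∈ Finset.range (l + 1), c i • r i
        = ∑ i ∈ Finset.range (l + 1), c i • (r i - r 0) := by
      simp only [smul_sub, Finset.sum_sub_distrib, ← Finset.sum_smul, hc, zero_smul, sub_zero]
    rw [this]
    refine Submodule.sum_mem _ fun i hi => Submodule.smul_mem _ _ (Submodule.subset_span ?_)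
    exact ⟨i, by simpa using hi, rfl⟩
  rw [← hb2, ← sub_sub]
  exact Submodule.starProjection_inner_eq_zero (y - r 0) _ h1

lemma dim_bound {P : ℕ} (r : ℕ → EuclideanSpace ℝ (Fin P)) (m : ℕ)
    (h : ∀ i, 1 ≤ i → i ≤ m → 0 < Metric.infDist (r i) (affSpan r (i - 1))) : m ≤ P := by
  have key : ∀ l, l ≤ m → l ≤ Module.finrank ℝ
      (Submodule.span ℝ ((fun i => r i - r 0) '' (Finset.range (l + 1) : Set ℕ))) := by
    intro l
    induction l with
    | zero => simp
    | succ l ih =>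
      intro hl
      refine Nat.succ_le_of_lt (lt_of_le_of_lt (ih (by omega)) ?_)
      apply Submodule.finrank_lt_finrank_of_lt
      have hne : r (l + 1) - r 0 ∉
          Submodule.span ℝ ((fun i => r i - r 0) '' (Finset.range (l + 1) : Set ℕ)) := by
        intro hmem
        have h2 : r (l + 1) ∈ affSpan r l := coef_of_mem_span r l _ hmem
        have h3 := h (l + 1) (by omega) hl
        rw [Nat.add_sub_cancel, Metric.infDist_zero_of_mem h2] at h3
        exact lt_irrefl _ h3
      refine lt_of_le_of_ne (Submodule.span_mono (Set.image_mono ?_)) ?_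
      · intro i hi
        simp at hi ⊢
        omega
      · intro heq
        apply hne
        rw [heq]
        exact Submodule.subset_span ⟨l + 1, by simp, rfl⟩
  have h1 := key m le_rfl
  have h2 := Submodule.finrank_le
    (Submodule.span ℝ ((fun i => r i - r 0) '' (Finset.range (m + 1) : Set ℕ)))
  simp only [finrank_euclideanSpace, Fintype.card_fin] at h2
  omega

lemma proj_norm {E : Type*} [NormedAddCommGroup E] [InnerProductSpace ℝ E] (u v a : E)
    (h : inner ℝ (u - v) (v - a) = 0) : ‖v‖ ≤ ‖u‖ + 2 * ‖a‖ := by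
  have h1 : ‖v - a‖ ≤ ‖u - a‖ := by
    have h2 : ‖u - a‖ * ‖u - a‖ = ‖u - v‖ * ‖u - v‖ + ‖v - a‖ * ‖v - a‖ := by
      rw [← norm_add_sq_eq_norm_sq_add_norm_sq_of_inner_eq_zero _ _ h]
      simp
    nlinarith [norm_nonneg (u - a), norm_nonneg (v - a), mul_self_nonneg ‖u - v‖]
  have h3 : ‖v‖ ≤ ‖v - a‖ + ‖a‖ := by simpa using norm_add_le (v - a) a
  have h4 := norm_sub_le u a
  linarith

lemma coef_bound {P : ℕ} (r : ℕ → EuclideanSpace ℝ (Fin P)) (t N : ℝ) (ht : 0 < t) (m : ℕ) :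
    ∀ A : ℝ, 1 ≤ A → 2 * m + A ≤ N →
    (∀ i, 1 ≤ i → i ≤ m → 0 < Metric.infDist (r i) (affSpan r (i - 1))) →
    (∀ i, 1 ≤ i → i ≤ m → ∀ j, i ≤ j → j ≤ m →
      t * ‖r j‖ ≤ Metric.infDist (r i) (affSpan r (i - 1))) →
    ∀ c : ℕ → ℝ, (∑ i ∈ Finset.range (m + 1), c i) = 1 →
    (∀ i, 1 ≤ i → i ≤ m → t * ‖∑ i ∈ Finset.range (m + 1), c i • r i‖ ≤
      A * Metric.infDist (r i) (affSpan r (i - 1))) →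
    ∀ j, j ≤ m → |c j| ≤ (2 + N / t) ^ m := by
  induction m with
  | zero =>
    intro A hA hN hpos hd c hc hz j hj
    obtain rfl : j = 0 := by omega
    simp at hc
    simp [hc]
  | succ m ih =>
    intro A hA hN hpos hd c hc hz j hj
    push_cast at hN
    have hm0 : (0 : ℝ) ≤ m := Nat.cast_nonneg m
    obtain ⟨b, hb, horth⟩ := exists_proj r m (r (m + 1))
    set pr := ∑ i ∈ Finset.range (m + 1), b i • r i with hpr
    set q := r (m + 1) - pr with hq
    set z := ∑ i ∈ Finset.range (m + 1 + 1), c i • r i with hzdef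
    set W := 2 + N / t with hW
    have hW1 : 1 ≤ W := by
      have : 0 ≤ N / t := by apply div_nonneg _ ht.le; linarith
      linarith
    have hprmem : pr ∈ affSpan r m := ⟨b, hb, rfl⟩
    have hdq : Metric.infDist (r (m + 1)) (affSpan r m) ≤ ‖q‖ := by
      rw [hq, ← dist_eq_norm]
      exact Metric.infDist_le_dist_of_mem hprmem
    have hqpos : 0 < ‖q‖ := lt_of_lt_of_le (by simpa using hpos (m + 1) (by omega) le_rfl) hdq
    have hrq : t * ‖r (m + 1)‖ ≤ ‖q‖ :=
      le_trans (by simpa using hd (m + 1) (by omega) le_rfl (m + 1) le_rfl le_rfl) hdq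
    have hzq : t * ‖z‖ ≤ A * ‖q‖ :=
      le_trans (by simpa using hz (m + 1) (by omega) le_rfl)
        (mul_le_mul_of_nonneg_left hdq (by linarith))
    -- the reduced coefficients
    set c' : ℕ → ℝ := fun i => c i + c (m + 1) * b i with hc'
    have hc'1 : ∑ i ∈ Finset.range (m + 1), c' i = 1 := by
      simp only [hc', Finset.sum_add_distrib, ← Finset.mul_sum, hb]
      rw [Finset.sum_range_succ] at hc
      linarith
    set z' := ∑ i ∈ Finset.range (m + 1), c' i • r i with hz'
    have hzz' : z - z' = c (m + 1) • q := by
      simp only [hz', hc', add_smul, mul_smul, Finset.sum_add_distrib, ← Finset.smul_sum]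
      rw [← hpr, hzdef, Finset.sum_range_succ, hq, smul_sub]
      abel
    -- orthogonality against differences of points in the affine span
    have horth2 : ∀ e e' : ℕ → ℝ, ∑ i ∈ Finset.range (m + 1), e i = 1 →
        ∑ i ∈ Finset.range (m + 1), e' i = 1 →
        inner ℝ q (∑ i ∈ Finset.range (m + 1), e i • r i
          - ∑ i ∈ Finset.range (m + 1), e' i • r i) = 0 := by
      intro e e' he he'
      have := horth (fun i => e i - e' i) (by rw [Finset.sum_sub_distrib, he, he', sub_self])
      simpa only [sub_smul, Finset.sum_sub_distrib] using this
    set a : ℕ → ℝ := fun i => if i = m then 1 else 0 with ha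
    have ha1 : ∑ i ∈ Finset.range (m + 1), a i = 1 := by simp [ha]
    have ha2 : ∑ i ∈ Finset.range (m + 1), a i • r i = r m := by simp [ha]
    have hz'n : ‖z'‖ ≤ ‖z‖ + 2 * ‖r m‖ := by
      apply proj_norm
      rw [hzz', inner_smul_left, ← ha2, horth2 c' a hc'1 ha1, mul_zero]
    have hprn : ‖pr‖ ≤ ‖r (m + 1)‖ + 2 * ‖r m‖ := by
      apply proj_norm
      rw [← ha2]
      exact horth2 b a hb ha1
    have hN' : 2 * (m : ℝ) + (A + 2) ≤ N := by linarith
    have hposm : ∀ i, 1 ≤ i → i ≤ m → 0 < Metric.infDist (r i) (affSpan r (i - 1)) :=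
      fun i h1 h2 => hpos i h1 (by omega)
    have hdm : ∀ i, 1 ≤ i → i ≤ m → ∀ j, i ≤ j → j ≤ m →
        t * ‖r j‖ ≤ Metric.infDist (r i) (affSpan r (i - 1)) :=
      fun i h1 h2 j h3 h4 => hd i h1 (by omega) j h3 (by omega)
    have hbb : ∀ j, j ≤ m → |b j| ≤ W ^ m := by
      refine ih (A + 2) (by linarith) hN' hposm hdm b hb ?_
      intro i h1 h2
      have e1 := hd i h1 (by omega) (m + 1) (by omega) le_rfl
      have e2 := hd i h1 (by omega) m (by omega) (by omega)
      have e3 := mul_le_mul_of_nonneg_left hprn ht.le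
      have e4 := hposm i h1 h2
      rw [← hpr]
      nlinarith
    have hcb : ∀ j, j ≤ m → |c' j| ≤ W ^ m := by
      refine ih (A + 2) (by linarith) hN' hposm hdm c' hc'1 ?_
      intro i h1 h2
      have e1 := hz i h1 (by omega)
      have e2 := hd i h1 (by omega) m (by omega) (by omega)
      have e3 := mul_le_mul_of_nonneg_left hz'n ht.le
      rw [← hz']
      nlinarith
    have hcm : |c (m + 1)| ≤ W - 1 := by
      -- inner q (z - r (m+1)) = (c (m+1) - 1) * ‖q‖^2
      have e1 : inner ℝ q (z - r (m + 1)) = (c (m + 1) - 1) * (‖q‖ * ‖q‖) := by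
        have : z - r (m + 1) = (c (m + 1) - 1) • q + (z' - pr) := by
          have h1 : z = z' + c (m + 1) • q := by rw [← hzz']; abel
          rw [h1, sub_smul, one_smul]
          simp only [hq]
          abel
        rw [this, inner_add_right, inner_smul_right, horth2 c' b hc'1 hb,
          real_inner_self_eq_norm_mul_norm, add_zero]
      have e2 : |c (m + 1) - 1| * (‖q‖ * ‖q‖) ≤ ‖q‖ * ‖z - r (m + 1)‖ := by
        rw [← abs_of_nonneg (mul_self_nonneg ‖q‖), ← abs_mul, ← e1]
        exact abs_real_inner_le_norm _ _
      have e3 : |c (m + 1) - 1| * ‖q‖ ≤ ‖z‖ + ‖r (m + 1)‖ := by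
        refine le_trans ?_ (norm_sub_le z (r (m + 1)))
        refine le_of_mul_le_mul_left ?_ hqpos
        linarith
      have e4 : |c (m + 1) - 1| * t ≤ A + 1 := by
        refine le_of_mul_le_mul_right ?_ hqpos
        nlinarith [mul_le_mul_of_nonneg_left e3 ht.le]
      have e5 : |c (m + 1) - 1| ≤ N / t := by
        rw [le_div_iff₀ ht]
        linarith
      have e6 : |c (m + 1)| ≤ |c (m + 1) - 1| + 1 := by
        simpa using abs_add_le (c (m + 1) - 1) 1
      linarith
    have hWm : 1 ≤ W ^ m := one_le_pow₀ hW1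
    rcases Nat.lt_or_ge j (m + 1) with hj' | hj'
    · have e1 : c j = c' j - c (m + 1) * b j := by simp [hc']
      have e2 : |c (m + 1) * b j| ≤ (W - 1) * W ^ m := by
        rw [abs_mul]
        exact mul_le_mul hcm (hbb j (by omega)) (abs_nonneg _) (by linarith)
      have e3 := hcb j (by omega)
      rw [e1, pow_succ]
      have e4 := abs_sub (c' j) (c (m + 1) * b j)
      nlinarith
    · obtain rfl : j = m + 1 := by omega
      rw [pow_succ]
      nlinarith

lemma const_bound (p m : ℕ) (hm : m ≤ p) (hm1 : 1 ≤ m) (t : ℝ) (ht : 0 < t) :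
    ((2 + (2 * p + 1 : ℝ) / t) ^ m) ^ 2 ≤
      (2 * (2 * p + 2 : ℝ)) ^ (2 * p) * (1 + (t ^ (2 * m))⁻¹) := by
  have hu : 0 < t⁻¹ := inv_pos.mpr ht
  have hp : (1 : ℝ) ≤ p := by exact_mod_cast hm1.trans hm
  have h1 : 2 + (2 * p + 1 : ℝ) / t ≤ (2 * p + 2) * (1 + t⁻¹) := by
    rw [div_eq_mul_inv]; nlinarith
  have h2 : (1 + t⁻¹) ^ (2 * m) ≤ 2 ^ (2 * p) * (1 + (t ^ (2 * m))⁻¹) := by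
    refine (add_pow_le zero_le_one hu.le (2 * m)).trans ?_
    rw [one_pow, inv_pow]
    refine mul_le_mul_of_nonneg_right (pow_le_pow_right₀ (by norm_num) (by omega)) (by positivity)
  calc ((2 + (2 * p + 1 : ℝ) / t) ^ m) ^ 2 = (2 + (2 * p + 1 : ℝ) / t) ^ (2 * m) := by
        rw [← pow_mul, Nat.mul_comm]
    _ ≤ ((2 * p + 2) * (1 + t⁻¹)) ^ (2 * m) := pow_le_pow_left₀ (by positivity) h1 _
    _ = (2 * p + 2) ^ (2 * m) * (1 + t⁻¹) ^ (2 * m) := mul_pow _ _ _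
    _ ≤ (2 * p + 2) ^ (2 * p) * (2 ^ (2 * p) * (1 + (t ^ (2 * m))⁻¹)) := by
        refine mul_le_mul (pow_le_pow_right₀ (by linarith) (by omega)) h2 (by positivity)
          (by positivity)
    _ = _ := by rw [mul_pow 2]; ring

set_option maxHeartbeats 2000000 in
/-- Main estimates of the key lemma (version A, `Σ = ℝⁿ`): under Assumptions
1 and 2 and the local `C²` estimates on the neighbourhood `U` of `x*`, there is a constant
`κ > 0`, depending only on the framework data (not on `m`, `t` or the points), such that for
any window of points in `U \ {x*}` whose error vectors satisfy the distance lower bound, the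
new iterate `x⁽ᵏ⁺¹⁾ = Σ c̃ᵢ g(x⁽ᵏ⁻ᵐ⁺ⁱ⁾)` satisfies
`‖r⁽ᵏ⁺¹⁾‖ ≤ K·dist₂(0,𝒜) + κ(1+t^{−2m}) max ‖r⁽ᵏ⁻ᵐ⁺ⁱ⁾‖²` and
`(1−K)‖r⁽ᵏ⁺¹⁾‖ ≤ K·dist₂(r⁽ᵏ⁺¹⁾,𝒜) + κ(1+t^{−2m}) max ‖r⁽ᵏ⁻ᵐ⁺ⁱ⁾‖²`. -/
theorem stmt6
    (n p : ℕ) (hn : 0 < n) (hp : 0 < p)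
    (V U : Set (EuclideanSpace ℝ (Fin n)))
    (f : EuclideanSpace ℝ (Fin n) → EuclideanSpace ℝ (Fin p))
    (g : EuclideanSpace ℝ (Fin n) → EuclideanSpace ℝ (Fin n))
    (xs : EuclideanSpace ℝ (Fin n)) (K σ L L' : ℝ)
    (hV : IsOpen V) (hxsV : xs ∈ V)
    (hf : ContDiffOn ℝ 2 f V) (hg : ContDiffOn ℝ 2 g V)
    (hfix : g xs = xs) (hroot : f xs = 0)
    (hK0 : 0 < K) (hK1 : K < 1)
    (hA1 : ∀ x ∈ V, g x ∈ V → ‖f (g x)‖ ≤ K * ‖f x‖)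
    (hσ : 0 < σ) (hA2 : ∀ x ∈ V, σ * ‖x - xs‖ ≤ ‖f x‖)
    (hU : U ∈ nhds xs) (hUV : U ⊆ V) (hUg : ∀ x ∈ U, g x ∈ V)
    (hL : 0 < L) (hL' : 0 < L')
    (hlip1 : ∀ x ∈ U, ∀ y ∈ U, ‖f x - f y‖ ≤ 2 * ‖fderiv ℝ f xs‖ * ‖x - y‖)
    (hlip2 : ∀ x ∈ U, ∀ y ∈ U,
      ‖f (g x) - f (g y)‖ ≤ 2 * ‖(fderiv ℝ f xs).comp (fderiv ℝ g xs)‖ * ‖x - y‖)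
    (htay1 : ∀ x ∈ U, ‖f x - fderiv ℝ f xs (x - xs)‖ ≤ L / 2 * ‖x - xs‖ ^ 2)
    (htay2 : ∀ x ∈ U, ‖g x - xs - fderiv ℝ g xs (x - xs)‖ ≤ L' / 2 * ‖x - xs‖ ^ 2) :
    ∃ κ : ℝ, 0 < κ ∧
      ∀ k m : ℕ, 1 ≤ m → m ≤ k →
      ∀ x : ℕ → EuclideanSpace ℝ (Fin n),
      (∀ i, k - m ≤ i → i ≤ k → x i ∈ U ∧ x i ≠ xs) →
      ∀ t : ℝ, 0 < t →
      (∀ i, 1 ≤ i → i ≤ m → ∀ j, i ≤ j → j ≤ m →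
        t * ‖f (x (k - m + j))‖ ≤
          Metric.infDist (f (x (k - m + i)))
            (affSpan (fun i' => f (x (k - m + i'))) (i - 1))) →
      ∀ ct : ℕ → ℝ,
      (∑ i ∈ Finset.range (m + 1), ct i) = 1 →
      ‖∑ i ∈ Finset.range (m + 1), ct i • f (x (k - m + i))‖ =
        Metric.infDist 0 (affSpan (fun i' => f (x (k - m + i'))) m) →
      (∑ i ∈ Finset.range (m + 1), ct i • x (k - m + i)) ∈ U →
      g (∑ i ∈ Finset.range (m + 1), ct i • x (k - m + i)) ∈ U →
      (∑ i ∈ Finset.range (m + 1), ct i • g (x (k - m + i))) ∈ U →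
      ‖f (∑ i ∈ Finset.range (m + 1), ct i • g (x (k - m + i)))‖ ≤
          K * Metric.infDist 0 (affSpan (fun i' => f (x (k - m + i'))) m) +
            κ * (1 + (t ^ (2 * m))⁻¹) *
              (⨆ i : Fin (m + 1), ‖f (x (k - m + (i : ℕ)))‖ ^ 2) ∧
        (1 - K) * ‖f (∑ i ∈ Finset.range (m + 1), ct i • g (x (k - m + i)))‖ ≤
          K * Metric.infDist (f (∑ i ∈ Finset.range (m + 1), ct i • g (x (k - m + i))))
              (affSpan (fun i' => f (x (k - m + i'))) m) +
            κ * (1 + (t ^ (2 * m))⁻¹) *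
              (⨆ i : Fin (m + 1), ‖f (x (k - m + (i : ℕ)))‖ ^ 2) := by
  set A := fderiv ℝ f xs with hAdef
  set G := fderiv ℝ g xs with hGdef
  set C0 : ℝ := (2 * (2 * p + 2 : ℝ)) ^ (2 * p) with hC0
  have hC0pos : 0 < C0 := by positivity
  refine ⟨(2 * ‖A‖ * L' + K * L) * ((p + 1) ^ 2 * C0 / σ ^ 2), by positivity, ?_⟩
  intro k m hm1 hmk x hx t ht hd ct hct hmin hxt hgxt hx1
  set r : ℕ → EuclideanSpace ℝ (Fin p) := fun i' => f (x (k - m + i')) with hr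
  set M := ⨆ i : Fin (m + 1), ‖f (x (k - m + (i : ℕ)))‖ ^ 2 with hM
  set T := 1 + (t ^ (2 * m))⁻¹ with hT
  set xt := ∑ i ∈ Finset.range (m + 1), ct i • x (k - m + i) with hxtdef
  set xn := ∑ i ∈ Finset.range (m + 1), ct i • g (x (k - m + i)) with hxndef
  have hxU : ∀ i ∈ Finset.range (m + 1), x (k - m + i) ∈ U := fun i hi =>
    (hx _ (by omega) (by have := Finset.mem_range.mp hi; omega)).1
  have he : ∀ i ∈ Finset.range (m + 1), ‖x (k - m + i) - xs‖ ≤ ‖r i‖ / σ := fun i hi => by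
    rw [le_div_iff₀ hσ, mul_comm]
    exact hA2 _ (hUV (hxU i hi))
  have hrpos : ∀ i ≤ m, 0 < ‖r i‖ := fun i hi => by
    have h1 := hx (k - m + i) (by omega) (by omega)
    refine lt_of_lt_of_le (mul_pos hσ (norm_pos_iff.mpr (sub_ne_zero.mpr h1.2))) (hA2 _ (hUV h1.1))
  have hpos : ∀ i, 1 ≤ i → i ≤ m → 0 < Metric.infDist (r i) (affSpan r (i - 1)) :=
    fun i h1 h2 => lt_of_lt_of_le (mul_pos ht (hrpos i h2)) (hd i h1 h2 i le_rfl h2)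
  have hmp : m ≤ p := dim_bound r m hpos
  have hmpR : (m : ℝ) ≤ p := by exact_mod_cast hmp
  have hmem : ∀ i ≤ m, r i ∈ affSpan r m := fun i hi => by
    refine ⟨fun j => if j = i then 1 else 0, ?_, ?_⟩
    · simp; omega
    · simp; omega
  set B := (2 + (2 * p + 1 : ℝ) / t) ^ m with hB
  have hcB : ∀ j, j ≤ m → |ct j| ≤ B := by
    refine coef_bound r t (2 * p + 1) ht m 1 le_rfl (by linarith) hpos hd ct hct ?_
    intro i h1 h2
    rw [one_mul]
    refine le_trans (mul_le_mul_of_nonneg_left ?_ ht.le) (hd i h1 h2 i le_rfl h2)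
    refine hmin.le.trans ((Metric.infDist_le_dist_of_mem (hmem i h2)).trans ?_)
    rw [dist_zero_left]
  have hB1 : 1 ≤ B := one_le_pow₀ (by have : 0 ≤ (2 * p + 1 : ℝ) / t := by positivity
                                      linarith)
  have hB2 : B ^ 2 ≤ C0 * T := const_bound p m hmp hm1 t ht
  have hrM : ∀ i ∈ Finset.range (m + 1), ‖r i‖ ^ 2 ≤ M := fun i hi => by
    exact le_ciSup (f := fun i : Fin (m + 1) => ‖f (x (k - m + (i : ℕ)))‖ ^ 2)
      (Set.finite_range _).bddAbove ⟨i, Finset.mem_range.mp hi⟩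
  have hM0 : 0 ≤ M := (sq_nonneg _).trans (hrM 0 (by simp))
  have heM : ∀ i ∈ Finset.range (m + 1), ‖x (k - m + i) - xs‖ ^ 2 ≤ M / σ ^ 2 := fun i hi => by
    refine (pow_le_pow_left₀ (norm_nonneg _) (he i hi) 2).trans ?_
    rw [div_pow]
    exact div_le_div_of_nonneg_right (hrM i hi) (by positivity)
  set Q := (p + 1 : ℝ) ^ 2 * (C0 * T) * (M / σ ^ 2) with hQ
  have hMs : 0 ≤ M / σ ^ 2 := by positivity
  set S := ∑ i ∈ Finset.range (m + 1), |ct i| * ‖x (k - m + i) - xs‖ ^ 2 with hS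
  have hSQ : S ≤ Q := by
    have h1 : S ≤ ∑ i ∈ Finset.range (m + 1), B * (M / σ ^ 2) :=
      Finset.sum_le_sum fun i hi => mul_le_mul (hcB i (by have := Finset.mem_range.mp hi; omega))
        (heM i hi) (by positivity) (by linarith)
    rw [Finset.sum_const, Finset.card_range, nsmul_eq_mul] at h1
    push_cast at h1
    refine h1.trans ?_
    rw [hQ, ← mul_assoc]
    refine mul_le_mul_of_nonneg_right ?_ hMs
    refine mul_le_mul ?_ (by nlinarith) (by linarith) (by positivity)
    nlinarith
  have hsub : xt - xs = ∑ i ∈ Finset.range (m + 1), ct i • (x (k - m + i) - xs) := by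
    simp only [smul_sub, Finset.sum_sub_distrib, ← Finset.sum_smul, hct, one_smul, hxtdef]
  have hEQ : ‖xt - xs‖ ^ 2 ≤ Q := by
    have h1 : ‖xt - xs‖ ≤ ∑ i ∈ Finset.range (m + 1), |ct i| * ‖x (k - m + i) - xs‖ := by
      rw [hsub]
      refine (norm_sum_le _ _).trans (le_of_eq (Finset.sum_congr rfl fun i _ => ?_))
      rw [norm_smul, Real.norm_eq_abs]
    have h2 := (pow_le_pow_left₀ (norm_nonneg _) h1 2).trans sq_sum_le_card_mul_sum_sq
    have h3 : ∑ i ∈ Finset.range (m + 1), (|ct i| * ‖x (k - m + i) - xs‖) ^ 2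
        ≤ ∑ i ∈ Finset.range (m + 1), B ^ 2 * (M / σ ^ 2) :=
      Finset.sum_le_sum fun i hi => by
        rw [mul_pow]
        exact mul_le_mul (pow_le_pow_left₀ (abs_nonneg _)
          (hcB i (by have := Finset.mem_range.mp hi; omega)) 2) (heM i hi) (by positivity)
          (by positivity)
    rw [Finset.sum_const, Finset.card_range, nsmul_eq_mul] at h3
    rw [Finset.card_range] at h2
    push_cast at h2 h3
    refine (h2.trans (mul_le_mul_of_nonneg_left h3 (by positivity))).trans ?_
    have : ((m : ℝ) + 1) * ((m + 1) * (B ^ 2 * (M / σ ^ 2)))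
      = ((m + 1) ^ 2 * B ^ 2) * (M / σ ^ 2) := by ring
    rw [this, hQ]
    refine mul_le_mul_of_nonneg_right ?_ hMs
    refine mul_le_mul (pow_le_pow_left₀ (by positivity) (by linarith) 2) hB2 (by positivity)
      (by positivity)
  -- Taylor estimate for a weighted sum
  have hft : ‖f xt - ∑ i ∈ Finset.range (m + 1), ct i • f (x (k - m + i))‖
      ≤ L / 2 * (‖xt - xs‖ ^ 2 + S) := by
    have e1 : f xt - ∑ i ∈ Finset.range (m + 1), ct i • f (x (k - m + i))
        = (f xt - A (xt - xs)) - ∑ i ∈ Finset.range (m + 1),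
          ct i • (f (x (k - m + i)) - A (x (k - m + i) - xs)) := by
      have : A (xt - xs) = ∑ i ∈ Finset.range (m + 1), ct i • A (x (k - m + i) - xs) := by
        rw [hsub, map_sum]; simp only [map_smul]
      rw [this]
      simp only [smul_sub, Finset.sum_sub_distrib]
      abel
    have e2 : ‖∑ i ∈ Finset.range (m + 1),
          ct i • (f (x (k - m + i)) - A (x (k - m + i) - xs))‖ ≤ L / 2 * S := by
      rw [hS, Finset.mul_sum]
      refine norm_sum_le_of_le _ fun i hi => ?_
      rw [norm_smul, Real.norm_eq_abs]
      have := mul_le_mul_of_nonneg_left (htay1 _ (hxU i hi)) (abs_nonneg (ct i))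
      linarith
    rw [e1]
    have e3 := htay1 xt hxt
    have e4 := norm_sub_le (f xt - A (xt - xs)) (∑ i ∈ Finset.range (m + 1),
          ct i • (f (x (k - m + i)) - A (x (k - m + i) - xs)))
    linarith
  have hgt : ‖xn - g xt‖ ≤ L' / 2 * (‖xt - xs‖ ^ 2 + S) := by
    have e1 : xn - g xt
        = (∑ i ∈ Finset.range (m + 1),
          ct i • (g (x (k - m + i)) - xs - G (x (k - m + i) - xs)))
          - (g xt - xs - G (xt - xs)) := by
      have : G (xt - xs) = ∑ i ∈ Finset.range (m + 1), ct i • G (x (k - m + i) - xs) := by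
        rw [hsub, map_sum]; simp only [map_smul]
      rw [this]
      simp only [smul_sub, Finset.sum_sub_distrib, ← Finset.sum_smul, hct, one_smul]
      rw [hxndef]
      abel
    have e2 : ‖∑ i ∈ Finset.range (m + 1),
          ct i • (g (x (k - m + i)) - xs - G (x (k - m + i) - xs))‖ ≤ L' / 2 * S := by
      rw [hS, Finset.mul_sum]
      refine norm_sum_le_of_le _ fun i hi => ?_
      rw [norm_smul, Real.norm_eq_abs]
      have := mul_le_mul_of_nonneg_left (htay2 _ (hxU i hi)) (abs_nonneg (ct i))
      linarith
    rw [e1]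
    have e3 := htay2 xt hxt
    have e4 := norm_sub_le (∑ i ∈ Finset.range (m + 1),
          ct i • (g (x (k - m + i)) - xs - G (x (k - m + i) - xs))) (g xt - xs - G (xt - xs))
    linarith
  have main : ‖f xn‖ ≤ K * Metric.infDist 0 (affSpan r m) +
      (2 * ‖A‖ * L' + K * L) * ((p + 1) ^ 2 * C0 / σ ^ 2) * T * M := by
    have hQeq : (2 * ‖A‖ * L' + K * L) * ((p + 1) ^ 2 * C0 / σ ^ 2) * T * M
        = (2 * ‖A‖ * L' + K * L) * Q := by rw [hQ]; ring
    rw [hQeq, ← hmin]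
    have hg1 : ‖xn - g xt‖ ≤ L' * Q := hgt.trans (by nlinarith)
    have hf1 : ‖f xt - ∑ i ∈ Finset.range (m + 1), ct i • f (x (k - m + i))‖ ≤ L * Q :=
      hft.trans (by nlinarith)
    have h1 := hlip1 xn hx1 (g xt) hgxt
    have h2 := hA1 xt (hUV hxt) (hUg xt hxt)
    have h3 : ‖f xn‖ ≤ ‖f xn - f (g xt)‖ + ‖f (g xt)‖ := by
      simpa using norm_add_le (f xn - f (g xt)) (f (g xt))
    have h4 : ‖f xt‖ ≤ ‖f xt - ∑ i ∈ Finset.range (m + 1), ct i • f (x (k - m + i))‖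
        + ‖∑ i ∈ Finset.range (m + 1), ct i • f (x (k - m + i))‖ := by
      simpa using norm_add_le (f xt - ∑ i ∈ Finset.range (m + 1), ct i • f (x (k - m + i)))
        (∑ i ∈ Finset.range (m + 1), ct i • f (x (k - m + i)))
    have h5 := mul_le_mul_of_nonneg_left hg1 (by positivity : 0 ≤ 2 * ‖A‖)
    have h6 := mul_le_mul_of_nonneg_left (h4.trans (add_le_add_left hf1 _)) hK0.le
    have h7 : K * (L * Q + ‖∑ i ∈ Finset.range (m + 1), ct i • f (x (k - m + i))‖)
      = K * L * Q + K * ‖∑ i ∈ Finset.range (m + 1), ct i • f (x (k - m + i))‖ := by ring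
    have h8 : 2 * ‖A‖ * (L' * Q) + K * L * Q = (2 * ‖A‖ * L' + K * L) * Q := by ring
    linarith
  refine ⟨main, ?_⟩
  have h9 : Metric.infDist 0 (affSpan r m) ≤ Metric.infDist (f xn) (affSpan r m) + ‖f xn‖ := by
    have := Metric.infDist_le_infDist_add_dist (s := affSpan r m) (x := 0) (y := f xn)
    rwa [dist_zero_left] at this
  have h10 := mul_le_mul_of_nonneg_left h9 hK0.le
  linarith
end

section
/- In the abstract framework (case Σ = ℝⁿ), let Assumptions 1 and 2 hold and let μ be a real number with K < μ < 1. There exists a positive constant R_μ such that for every restart parameter τ ∈ (0,1): if x⁽⁰⁾ ∈ U satisfies 0 < ‖r⁽⁰⁾‖₂ ≤ R_μ τ^{2p} and one runs version A of the restarted Anderson–Pulay acceleration, then the sequences (x⁽ᵏ⁾) and (r⁽ᵏ⁾) are well defined and, as long as ‖r⁽ᵏ⁾‖₂ is nonzero: (1) m_k ≤ min(k, p); (2) ‖c⁽ᵏ⁾‖_∞ ≤ C_{m_k}(1 + (τ(1−μ))^{−m_k}), where C_{m_k} > 0 depends only on m_k; (3) ‖r⁽ᵏ⁺¹⁾‖₂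 ≤ μ^{m_k+1}‖r⁽ᵏ⁻ᵐ_k⁾‖₂. Consequently ‖r⁽ᵏ⁾‖₂ ≤ μᵏ‖r⁽⁰⁾‖₂ for all k ∈ ℕ, so the method is locally r-linearly convergent. Moreover, there exists a positive constant Γ independent of τ such that, whenever a restart occurs at step k+1 (i.e. m_{k+1} = 0), one has (1 − K(1+τ))‖r⁽ᵏ⁺¹⁾‖₂ ≤ (Kτ + Γ τ^{−2m_k}‖r⁽ᵏ⁻ᵐ_k⁾‖₂) · ‖r⁽ᵏ⁻ᵐ_k⁾‖₂. -/
/-- A run `(x, m, c)` of version A of the restarted Anderson–Pulay acceleration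
(Algorithm 3) with error function `f`, fixed-point function `g` and restart parameter `τ`:
`m₀ = 0`; if `m_k = 0` then `x⁽ᵏ⁺¹⁾ = g(x⁽ᵏ⁾)`; if `m_k ≥ 1` then
`x⁽ᵏ⁺¹⁾ = Σ_{i=0}^{m_k} cᵢ⁽ᵏ⁾ g(x⁽ᵏ⁻ᵐ_k⁺ⁱ⁾)`, where `c⁽ᵏ⁾` minimizes
`‖Σ cᵢ r⁽ᵏ⁻ᵐ_k⁺ⁱ⁾‖₂` subject to `Σ cᵢ = 1`; then, with
`s⁽ᵏ⁺¹⁾ = r⁽ᵏ⁺¹⁾ − r⁽ᵏ⁻ᵐ_k⁾`, one restarts (`m_{k+1} = 0`) if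
`τ‖s⁽ᵏ⁺¹⁾‖₂ > ‖(id − Π_k)s⁽ᵏ⁺¹⁾‖₂` (the latter being the distance from `s⁽ᵏ⁺¹⁾` to the
span of the stored differences of error vectors), and sets `m_{k+1} = m_k + 1` otherwise;
with the convention that the run freezes (`x⁽ᵏ⁺¹⁾ = x⁽ᵏ⁾`, `m` = 0) once `r⁽ᵏ⁾ = 0`. -/
def RestartRun {n p : ℕ}
    (f : EuclideanSpace ℝ (Fin n) → EuclideanSpace ℝ (Fin p))
    (g : EuclideanSpace ℝ (Fin n) → EuclideanSpace ℝ (Fin n)) (τ : ℝ)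
    (x : ℕ → EuclideanSpace ℝ (Fin n)) (m : ℕ → ℕ) (c : ℕ → ℕ → ℝ) : Prop :=
  m 0 = 0 ∧
  ∀ k : ℕ,
    (f (x k) = 0 → x (k + 1) = x k) ∧
    (f (x (k + 1)) = 0 → m (k + 1) = 0) ∧
    (f (x k) ≠ 0 → m k = 0 → x (k + 1) = g (x k) ∧ c k 0 = 1) ∧
    (f (x k) ≠ 0 → 1 ≤ m k →
      (∑ i ∈ Finset.range (m k + 1), c k i) = 1 ∧
      (∀ d : ℕ → ℝ, (∑ i ∈ Finset.range (m k + 1), d i) = 1 →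
        ‖∑ i ∈ Finset.range (m k + 1), c k i • f (x (k - m k + i))‖ ≤
          ‖∑ i ∈ Finset.range (m k + 1), d i • f (x (k - m k + i))‖) ∧
      x (k + 1) = ∑ i ∈ Finset.range (m k + 1), c k i • g (x (k - m k + i))) ∧
    (f (x (k + 1)) ≠ 0 →
      (τ * ‖f (x (k + 1)) - f (x (k - m k))‖ >
          Metric.infDist (f (x (k + 1)) - f (x (k - m k)))
            (Submodule.span ℝ
              ((fun i => f (x (k - m k + i)) - f (x (k - m k))) '' Set.Icc 1 (m k)) :
              Set (EuclideanSpace ℝ (Fin p))) →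
        m (k + 1) = 0) ∧
      (τ * ‖f (x (k + 1)) - f (x (k - m k))‖ ≤
          Metric.infDist (f (x (k + 1)) - f (x (k - m k)))
            (Submodule.span ℝ
              ((fun i => f (x (k - m k + i)) - f (x (k - m k))) '' Set.Icc 1 (m k)) :
              Set (EuclideanSpace ℝ (Fin p))) →
        m (k + 1) = m k + 1))

/-- Existence of a least-squares minimizer. -/
lemma ap_exists_min {p : ℕ} (r : ℕ → EuclideanSpace ℝ (Fin p)) (m : ℕ) :
    ∃ c : ℕ → ℝ, (∑ i ∈ Finset.range (m + 1), c i) = 1 ∧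
      ∀ d : ℕ → ℝ, (∑ i ∈ Finset.range (m + 1), d i) = 1 →
        ‖∑ i ∈ Finset.range (m + 1), c i • r i‖ ≤ ‖∑ i ∈ Finset.range (m + 1), d i • r i‖ := by
  let T : (ℕ → ℝ) →ₗ[ℝ] EuclideanSpace ℝ (Fin p) :=
    { toFun := fun a => ∑ i ∈ Finset.range m, a (i + 1) • (r (i + 1) - r 0)
      map_add' := by
        intro a b
        simp [add_smul, Finset.sum_add_distrib]
      map_smul' := by
        intro t a
        simp [Finset.smul_sum, mul_smul] }
  have key : ∀ d : ℕ → ℝ, (∑ i ∈ Finset.range (m + 1), d i) = 1 →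
      ∑ i ∈ Finset.range (m + 1), d i • r i = r 0 + T d := by
    intro d hd
    have h0 : d 0 = 1 - ∑ i ∈ Finset.range m, d (i + 1) := by
      rw [Finset.sum_range_succ'] at hd; linarith
    rw [Finset.sum_range_succ', h0]
    simp only [T, LinearMap.coe_mk, AddHom.coe_mk, smul_sub, Finset.sum_sub_distrib, sub_smul,
      one_smul, Finset.sum_smul]
    abel
  have hcl : IsClosed (LinearMap.range T : Set (EuclideanSpace ℝ (Fin p))) :=
    Submodule.closed_of_finiteDimensional _
  obtain ⟨y, ⟨a, rfl⟩, hy⟩ := hcl.exists_infDist_eq_dist ⟨0, Submodule.zero_mem _⟩ (-(r 0))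
  let c : ℕ → ℝ := fun i => if i = 0 then 1 - ∑ i ∈ Finset.range m, a (i + 1) else a i
  have hc1 : (∑ i ∈ Finset.range (m + 1), c i) = 1 := by
    rw [Finset.sum_range_succ']; simp [c]
  have hTc : T c = T a := by simp [T, c]
  refine ⟨c, hc1, fun d hd => ?_⟩
  rw [key c hc1, key d hd, hTc]
  have h1 := Metric.infDist_le_dist_of_mem (x := -(r 0))
    (show T d ∈ (LinearMap.range T : Set (EuclideanSpace ℝ (Fin p))) from ⟨d, rfl⟩)
  rw [hy, dist_eq_norm, dist_eq_norm] at h1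
  have e : ∀ v : EuclideanSpace ℝ (Fin p), ‖r 0 + v‖ = ‖-r 0 - v‖ := by
    intro v; rw [← norm_neg]; congr 1; abel
  rw [e, e]; exact h1

/-- Coefficient bound for quasi-orthogonal families. -/
lemma ap_coeff {F : Type*} [NormedAddCommGroup F] [NormedSpace ℝ F] (τ : ℝ) (h0 : 0 < τ)
    (h1 : τ < 1) (t : ℕ → F) (c : ℕ → ℝ) (m : ℕ) :
    ∀ N : ℝ, (∀ i < m, τ * ‖t (i + 1)‖ ≤
        Metric.infDist (t (i + 1)) (Submodule.span ℝ (t '' Set.Icc 1 i) : Set F)) →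
      ‖∑ i ∈ Finset.range m, c (i + 1) • t (i + 1)‖ ≤ N →
      ∀ i < m, |c (i + 1)| * ‖t (i + 1)‖ ≤ (2 / τ) ^ m * N := by
  induction m with
  | zero => intro N _ _ i hi; omega
  | succ m ih =>
    intro N ht hN i hi
    have hN0 : 0 ≤ N := (norm_nonneg _).trans hN
    rw [Finset.sum_range_succ] at hN
    have hlast : |c (m + 1)| * ‖t (m + 1)‖ ≤ N / τ := by
      by_cases hc : c (m + 1) = 0
      · rw [hc]; simp; positivity
      · have hmem : -∑ i ∈ Finset.range m, ((c (m + 1))⁻¹ * c (i + 1)) • t (i + 1) ∈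
            (Submodule.span ℝ (t '' Set.Icc 1 m) : Set F) := by
          refine Submodule.neg_mem _ (Submodule.sum_mem _ fun j hj => Submodule.smul_mem _ _ ?_)
          apply Submodule.subset_span
          refine ⟨j + 1, ?_, rfl⟩
          have := Finset.mem_range.1 hj
          constructor <;> omega
        have h2 := (ht m (Nat.lt_succ_self m)).trans (Metric.infDist_le_dist_of_mem hmem)
        rw [dist_eq_norm, sub_neg_eq_add] at h2
        have h3 : ∑ i ∈ Finset.range m, c (i + 1) • t (i + 1) + c (m + 1) • t (m + 1) =
            c (m + 1) • (t (m + 1) +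
              ∑ i ∈ Finset.range m, ((c (m + 1))⁻¹ * c (i + 1)) • t (i + 1)) := by
          rw [smul_add, Finset.smul_sum, add_comm]
          congr 1
          refine Finset.sum_congr rfl fun j _ => ?_
          rw [smul_smul, mul_inv_cancel_left₀ hc]
        rw [h3, norm_smul, Real.norm_eq_abs] at hN
        rw [le_div_iff₀ h0]
        calc |c (m + 1)| * ‖t (m + 1)‖ * τ = |c (m + 1)| * (τ * ‖t (m + 1)‖) := by ring
          _ ≤ _ := (mul_le_mul_of_nonneg_left h2 (abs_nonneg _)).trans hN
    have h1τ : 1 ≤ 1 / τ := by rw [le_div_iff₀ h0]; linarith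
    have h2τ : 1 ≤ 2 / τ := by rw [le_div_iff₀ h0]; linarith
    have hNt : N ≤ N / τ := by rw [le_div_iff₀ h0]; nlinarith
    have hNt0 : 0 ≤ N / τ := by positivity
    have e2 : 2 / τ * N = N / τ + N / τ := by ring
    have hpow : 1 ≤ (2 / τ) ^ m := one_le_pow₀ h2τ
    have e3 : (2 / τ) ^ (m + 1) * N = (2 / τ) ^ m * (2 / τ * N) := by ring
    rw [e3]
    rcases Nat.lt_succ_iff_lt_or_eq.1 hi with h | h
    · refine ih (2 / τ * N) (fun j hj => ht j (by omega)) ?_ i h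
      have h4 : ‖∑ i ∈ Finset.range m, c (i + 1) • t (i + 1)‖ ≤
          ‖∑ i ∈ Finset.range m, c (i + 1) • t (i + 1) + c (m + 1) • t (m + 1)‖ +
            ‖c (m + 1) • t (m + 1)‖ := norm_le_add_norm_add _ _
      rw [norm_smul, Real.norm_eq_abs] at h4
      linarith
    · subst h
      nlinarith

lemma ap_card {p : ℕ} (τ : ℝ) (h0 : 0 < τ)
    (h1 : τ < 1) (t : ℕ → EuclideanSpace ℝ (Fin p)) (m : ℕ)
    (ht : ∀ i < m, τ * ‖t (i + 1)‖ ≤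
        Metric.infDist (t (i + 1)) (Submodule.span ℝ (t '' Set.Icc 1 i) :
          Set (EuclideanSpace ℝ (Fin p))))
    (hne : ∀ i < m, t (i + 1) ≠ 0) : m ≤ p := by
  have hli : LinearIndependent ℝ (fun i : Fin m => t (i + 1)) := by
    rw [Fintype.linearIndependent_iff]
    intro a ha i
    let c : ℕ → ℝ := fun j => if h : j - 1 < m then a ⟨j - 1, h⟩ else 0
    have hc : ∀ i : Fin m, c (i + 1) = a i := by
      intro i; simp [c]
    have hs : ‖∑ i ∈ Finset.range m, c (i + 1) • t (i + 1)‖ ≤ 0 := by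
      rw [Finset.sum_range (fun i => c (i + 1) • t (i + 1))]
      simp_rw [hc]
      rw [ha]; simp
    have h := ap_coeff τ h0 h1 t c m 0 ht hs i i.2
    rw [mul_zero, hc] at h
    have h2 : 0 < ‖t (i + 1)‖ := norm_pos_iff.2 (hne i i.2)
    have h3 : |a i| ≤ 0 := by
      by_contra hh
      push Not at hh
      have := mul_pos hh h2
      linarith
    exact abs_nonpos_iff.1 h3
  have := hli.fintype_card_le_finrank
  simpa using this

/-- Linearization of Assumption 1. -/
lemma ap_lin {E F : Type*} [NormedAddCommGroup E] [NormedSpace ℝ E]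
    [NormedAddCommGroup F] [NormedSpace ℝ F] (f : E → F) (g : E → E) (xs : E)
    (A : E →L[ℝ] F) (G : E →L[ℝ] E) (hf : HasFDerivAt f A xs) (hg : HasFDerivAt g G xs)
    (hgx : g xs = xs) (hfx : f xs = 0) (K : ℝ)
    (hK : ∀ᶠ x in nhds xs, ‖f (g x)‖ ≤ K * ‖f x‖) (w : E) : ‖A (G w)‖ ≤ K * ‖A w‖ := by
  have hfg : HasFDerivAt (f ∘ g) (A.comp G) xs := by
    apply HasFDerivAt.comp xs _ hg
    rw [hgx]; exact hf
  have hline : HasDerivAt (fun t : ℝ => xs + t • w) w 0 := by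
    have h := ((hasDerivAt_id (0:ℝ)).smul_const w).const_add xs
    simpa using h
  have d1 : HasDerivAt (fun t : ℝ => f (xs + t • w)) (A w) 0 := by
    have hf' : HasFDerivAt f A (xs + (0:ℝ) • w) := by simpa using hf
    exact hf'.comp_hasDerivAt (0:ℝ) hline
  have d2 : HasDerivAt (fun t : ℝ => f (g (xs + t • w))) (A (G w)) 0 := by
    have hf' : HasFDerivAt (f ∘ g) (A.comp G) (xs + (0:ℝ) • w) := by simpa using hfg
    have h := hf'.comp_hasDerivAt (0:ℝ) hline
    exact h
  have t1 := d1.tendsto_slope_zero.norm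
  have t2 := d2.tendsto_slope_zero.norm
  refine le_of_tendsto_of_tendsto t2 (t1.const_mul K) ?_
  have hc : Filter.Tendsto (fun t : ℝ => xs + t • w) (nhds 0) (nhds xs) := by
    have := hline.continuousAt.tendsto
    simpa using this
  have hev : ∀ᶠ t : ℝ in nhdsWithin 0 {0}ᶜ, ‖f (g (xs + t • w))‖ ≤ K * ‖f (xs + t • w)‖ :=
    (hc.eventually hK).filter_mono nhdsWithin_le_nhds
  filter_upwards [hev] with t ht
  simp only [zero_add, zero_smul, add_zero, hgx, hfx, sub_zero, norm_smul]
  calc ‖t⁻¹‖ * ‖f (g (xs + t • w))‖ ≤ ‖t⁻¹‖ * (K * ‖f (xs + t • w)‖) := by gcongr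
    _ = _ := by ring

/-- Norm of a combination. -/
lemma ap_sum_bound {F : Type*} [NormedAddCommGroup F] [NormedSpace ℝ F] (c : ℕ → ℝ)
    (v : ℕ → F) (m : ℕ) (D B : ℝ) (hD : 0 ≤ D) (hc : ∀ i ≤ m, |c i| ≤ D)
    (hv : ∀ i ≤ m, ‖v i‖ ≤ B) :
    ‖∑ i ∈ Finset.range (m + 1), c i • v i‖ ≤ ((m : ℝ) + 1) * D * B := by
  calc _ ≤ ∑ i ∈ Finset.range (m + 1), ‖c i • v i‖ := norm_sum_le _ _
    _ ≤ ∑ i ∈ Finset.range (m + 1), D * B := by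
        refine Finset.sum_le_sum fun i hi => ?_
        have hi' : i ≤ m := Nat.lt_succ_iff.1 (Finset.mem_range.1 hi)
        rw [norm_smul, Real.norm_eq_abs]
        exact mul_le_mul (hc i hi') (hv i hi') (norm_nonneg _) hD
    _ = _ := by simp; ring

/-- Quadratic one-step estimate. -/
lemma ap_quad {E F : Type*} [NormedAddCommGroup E] [NormedSpace ℝ E]
    [NormedAddCommGroup F] [NormedSpace ℝ F] (U : Set E) (f : E → F) (g : E → E) (xs : E)
    (A : E →L[ℝ] F) (G : E →L[ℝ] E) (K L L' e D : ℝ) (hK0 : 0 < K) (hK1 : K < 1)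
    (hL : 0 < L) (hL' : 0 < L') (hD : 1 ≤ D)
    (hlin : ∀ w, ‖A (G w)‖ ≤ K * ‖A w‖)
    (hTf : ∀ x ∈ U, ‖f x - A (x - xs)‖ ≤ L / 2 * ‖x - xs‖ ^ 2)
    (hTg : ∀ x ∈ U, ‖g x - xs - G (x - xs)‖ ≤ L' / 2 * ‖x - xs‖ ^ 2)
    (y : ℕ → E) (c : ℕ → ℝ) (m : ℕ) (hyU : ∀ i ≤ m, y i ∈ U) (hy : ∀ i ≤ m, ‖y i - xs‖ ≤ e)
    (hc : ∀ i ≤ m, |c i| ≤ D) (hc1 : (∑ i ∈ Finset.range (m + 1), c i) = 1)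
    (hgy : ∀ i ≤ m, ‖g (y i) - xs‖ ≤ e)
    (hzU : ∑ i ∈ Finset.range (m + 1), c i • g (y i) ∈ U) :
    ‖f (∑ i ∈ Finset.range (m + 1), c i • g (y i))‖ ≤
      K * ‖∑ i ∈ Finset.range (m + 1), c i • f (y i)‖ +
        (L + ‖A‖ * L') * (((m : ℝ) + 1) * D) ^ 2 * e ^ 2 := by
  have hD0 : 0 ≤ D := by linarith
  set z := ∑ i ∈ Finset.range (m + 1), c i • g (y i) with hz
  have hzx : z - xs = ∑ i ∈ Finset.range (m + 1), c i • (g (y i) - xs) := by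
    simp only [smul_sub, Finset.sum_sub_distrib, ← Finset.sum_smul, hc1, one_smul, hz]
  set w := ∑ i ∈ Finset.range (m + 1), c i • (y i - xs) with hw
  set M := ((m : ℝ) + 1) * D with hM
  have hM1 : 1 ≤ M := by
    have : (0:ℝ) ≤ m := Nat.cast_nonneg m
    nlinarith
  have hzn : ‖z - xs‖ ≤ M * e := by
    rw [hzx]; exact ap_sum_bound c _ m D e hD0 hc hgy
  have hsq : ∀ i ≤ m, ‖y i - xs‖ ^ 2 ≤ e ^ 2 := fun i hi => by
    have := hy i hi; gcongr
  have b1 : ‖f z - A (z - xs)‖ ≤ L / 2 * (M * e) ^ 2 := by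
    refine (hTf z hzU).trans ?_
    gcongr
  have b2 : ‖z - xs - G w‖ ≤ M * (L' / 2 * e ^ 2) := by
    have : z - xs - G w = ∑ i ∈ Finset.range (m + 1), c i • (g (y i) - xs - G (y i - xs)) := by
      rw [hzx, hw, map_sum, ← Finset.sum_sub_distrib]
      refine Finset.sum_congr rfl fun i _ => ?_
      rw [map_smul, smul_sub (c i) (g (y i) - xs)]
    rw [this]
    refine ap_sum_bound c _ m D _ hD0 hc fun i hi => (hTg _ (hyU i hi)).trans ?_
    have := hsq i hi
    gcongr
  have b3 : ‖∑ i ∈ Finset.range (m + 1), c i • f (y i) - A w‖ ≤ M * (L / 2 * e ^ 2) := by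
    have : ∑ i ∈ Finset.range (m + 1), c i • f (y i) - A w =
        ∑ i ∈ Finset.range (m + 1), c i • (f (y i) - A (y i - xs)) := by
      rw [hw, map_sum, ← Finset.sum_sub_distrib]
      refine Finset.sum_congr rfl fun i _ => ?_
      rw [map_smul, smul_sub (c i) (f (y i))]
    rw [this]
    refine ap_sum_bound c _ m D _ hD0 hc fun i hi => (hTf _ (hyU i hi)).trans ?_
    have := hsq i hi
    gcongr
  set S := ∑ i ∈ Finset.range (m + 1), c i • f (y i)
  have b4 : ‖A w‖ ≤ ‖S‖ + M * (L / 2 * e ^ 2) := by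
    have := norm_le_norm_add_norm_sub' (A w) S
    rw [norm_sub_rev] at this
    linarith
  have b5 : ‖A (z - xs - G w)‖ ≤ ‖A‖ * (M * (L' / 2 * e ^ 2)) :=
    (A.le_opNorm _).trans (by gcongr)
  have b6 : f z = (f z - A (z - xs)) + A (z - xs - G w) + A (G w) := by
    rw [map_sub A (z - xs)]; abel
  have b7 : ‖f z‖ ≤ ‖f z - A (z - xs)‖ + ‖A (z - xs - G w)‖ + ‖A (G w)‖ := by
    conv_lhs => rw [b6]
    exact norm_add₃_le
  have b8 := hlin w
  have b9 : K * ‖A w‖ ≤ K * ‖S‖ + M * (L / 2 * e ^ 2) := by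
    have h1 : K * ‖A w‖ ≤ K * (‖S‖ + M * (L / 2 * e ^ 2)) := by gcongr
    have h2 : 0 ≤ M * (L / 2 * e ^ 2) := by positivity
    nlinarith
  have hMM : M ≤ M ^ 2 := by nlinarith
  have c1 : M * (L / 2 * e ^ 2) ≤ M ^ 2 * (L / 2 * e ^ 2) := by gcongr
  have c2 : ‖A‖ * (M * (L' / 2 * e ^ 2)) ≤ ‖A‖ * (M ^ 2 * (L' * e ^ 2)) := by
    gcongr; linarith
  calc ‖f z‖ ≤ L / 2 * (M * e) ^ 2 + ‖A‖ * (M ^ 2 * (L' * e ^ 2)) +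
        (K * ‖S‖ + M ^ 2 * (L / 2 * e ^ 2)) := by linarith
    _ = _ := by ring

/-- Bound on the extrapolation coefficients. -/
lemma ap_cbound {F : Type*} [NormedAddCommGroup F] [NormedSpace ℝ F] (τ μ : ℝ) (h0 : 0 < τ)
    (h1 : τ < 1) (hμ0 : 0 < μ) (hμ1 : μ < 1) (r : ℕ → F) (c : ℕ → ℝ) (m : ℕ) (hr0 : r 0 ≠ 0)
    (hr : ∀ i ≤ m, ‖r i‖ ≤ μ ^ i * ‖r 0‖)
    (ht : ∀ i < m, τ * ‖r (i + 1) - r 0‖ ≤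
        Metric.infDist (r (i + 1) - r 0)
          (Submodule.span ℝ ((fun j => r j - r 0) '' Set.Icc 1 i) : Set F))
    (hc1 : (∑ i ∈ Finset.range (m + 1), c i) = 1)
    (hmin : ‖∑ i ∈ Finset.range (m + 1), c i • r i‖ ≤ ‖r 0‖) :
    (∀ i < m, (1 - μ) * ‖r 0‖ ≤ ‖r (i + 1) - r 0‖) ∧
    ∀ i ≤ m, |c i| ≤ 1 + m * 2 ^ (m + 1) * ((τ ^ m)⁻¹ * (1 - μ)⁻¹) := by
  have hrp : 0 < ‖r 0‖ := norm_pos_iff.2 hr0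
  have hs : ∀ i < m, (1 - μ) * ‖r 0‖ ≤ ‖r (i + 1) - r 0‖ := by
    intro i hi
    have h2 := hr (i + 1) (by omega)
    have h3 : μ ^ (i + 1) ≤ μ := by
      calc μ ^ (i + 1) ≤ μ ^ 1 := pow_le_pow_of_le_one hμ0.le hμ1.le (by omega)
        _ = μ := pow_one μ
    have h4 : ‖r 0‖ ≤ ‖r (i + 1)‖ + ‖r (i + 1) - r 0‖ := norm_le_norm_add_norm_sub _ _
    nlinarith
  refine ⟨hs, ?_⟩
  have hc0 : c 0 = 1 - ∑ i ∈ Finset.range m, c (i + 1) := by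
    rw [Finset.sum_range_succ'] at hc1; linarith
  have hS : ∑ i ∈ Finset.range (m + 1), c i • r i =
      r 0 + ∑ i ∈ Finset.range m, c (i + 1) • (r (i + 1) - r 0) := by
    rw [Finset.sum_range_succ', hc0]
    simp only [smul_sub, Finset.sum_sub_distrib, sub_smul, one_smul, Finset.sum_smul]
    abel
  rw [hS] at hmin
  have hN : ‖∑ i ∈ Finset.range m, c (i + 1) • (r (i + 1) - r 0)‖ ≤ 2 * ‖r 0‖ := by
    have := norm_le_add_norm_add (∑ i ∈ Finset.range m, c (i + 1) • (r (i + 1) - r 0)) (r 0)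
    rw [add_comm (∑ i ∈ Finset.range m, c (i + 1) • (r (i + 1) - r 0)) (r 0)] at this
    linarith
  have hco := ap_coeff τ h0 h1 (fun j => r j - r 0) c m (2 * ‖r 0‖) ht hN
  have hμ' : 0 < 1 - μ := by linarith
  set B := 2 ^ (m + 1) * ((τ ^ m)⁻¹ * (1 - μ)⁻¹) with hB
  have hB0 : 0 ≤ B := by positivity
  have hcB : ∀ i < m, |c (i + 1)| ≤ B := by
    intro i hi
    have h2 := hco i hi
    have h3 := mul_le_mul_of_nonneg_left (hs i hi) (abs_nonneg (c (i + 1)))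
    have h4 : |c (i + 1)| * ((1 - μ) * ‖r 0‖) ≤ B * ((1 - μ) * ‖r 0‖) := by
      refine (h3.trans h2).trans (le_of_eq ?_)
      rw [hB, div_pow]; field_simp; ring
    exact le_of_mul_le_mul_right h4 (by positivity)
  have hmB : (m : ℝ) * 2 ^ (m + 1) * ((τ ^ m)⁻¹ * (1 - μ)⁻¹) = m * B := by rw [hB]; ring
  rw [hmB]
  intro i hi
  rcases i with _ | i
  · rw [hc0]
    have h5 : |∑ i ∈ Finset.range m, c (i + 1)| ≤ m * B := by
      calc _ ≤ ∑ i ∈ Finset.range m, |c (i + 1)| := Finset.abs_sum_le_sum_abs _ _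
        _ ≤ ∑ i ∈ Finset.range m, B :=
            Finset.sum_le_sum fun i hi => hcB i (Finset.mem_range.1 hi)
        _ = _ := by simp
    have h6 := abs_sub (1:ℝ) (∑ i ∈ Finset.range m, c (i + 1))
    rw [abs_one] at h6
    linarith
  · have h7 := hcB i (by omega)
    have : (1:ℝ) ≤ m := by exact_mod_cast (by omega : 1 ≤ m)
    nlinarith

lemma ap_window {n p : ℕ} (U V : Set (EuclideanSpace ℝ (Fin n)))
    (f : EuclideanSpace ℝ (Fin n) → EuclideanSpace ℝ (Fin p))
    (g : EuclideanSpace ℝ (Fin n) → EuclideanSpace ℝ (Fin n))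
    (xs : EuclideanSpace ℝ (Fin n))
    (A : EuclideanSpace ℝ (Fin n) →L[ℝ] EuclideanSpace ℝ (Fin p))
    (G : EuclideanSpace ℝ (Fin n) →L[ℝ] EuclideanSpace ℝ (Fin n))
    (K σ L L' μ τ δ Rm Γ Q : ℝ) (hK0 : 0 < K) (hK1 : K < 1)
    (hK : ∀ x ∈ V, g x ∈ V → ‖f (g x)‖ ≤ K * ‖f x‖)
    (hσ : 0 < σ) (hσV : ∀ x ∈ V, σ * ‖x - xs‖ ≤ ‖f x‖)
    (hUV : U ⊆ V) (hgV : ∀ x ∈ U, g x ∈ V)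
    (hL : 0 < L) (hL' : 0 < L')
    (hlin : ∀ w, ‖A (G w)‖ ≤ K * ‖A w‖)
    (hTf : ∀ x ∈ U, ‖f x - A (x - xs)‖ ≤ L / 2 * ‖x - xs‖ ^ 2)
    (hTg : ∀ x ∈ U, ‖g x - xs - G (x - xs)‖ ≤ L' / 2 * ‖x - xs‖ ^ 2)
    (hKμ : K < μ) (hμ1 : μ < 1) (h0 : 0 < τ) (h1 : τ < 1)
    (hδ : Metric.ball xs δ ⊆ U) (hRm : 0 < Rm)
    (hQ : Q = ((p : ℝ) + 1) * (1 + p * 2 ^ (p + 1) * (1 - μ)⁻¹))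
    (hR1 : Q * Rm < δ * σ) (hΓ : Γ = (L + ‖A‖ * L') * Q ^ 2 / σ ^ 2)
    (hR2 : Γ * Rm ≤ (μ - K) * μ ^ p)
    (y : ℕ → EuclideanSpace ℝ (Fin n)) (c : ℕ → ℝ) (m : ℕ)
    (hyU : ∀ i ≤ m, y i ∈ U) (hy0 : f (y 0) ≠ 0) (hyR : ‖f (y 0)‖ ≤ Rm * τ ^ (2 * p))
    (hr : ∀ i ≤ m, ‖f (y i)‖ ≤ μ ^ i * ‖f (y 0)‖)
    (ht : ∀ i < m, τ * ‖f (y (i + 1)) - f (y 0)‖ ≤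
        Metric.infDist (f (y (i + 1)) - f (y 0))
          (Submodule.span ℝ ((fun j => f (y j) - f (y 0)) '' Set.Icc 1 i) :
            Set (EuclideanSpace ℝ (Fin p))))
    (hc1 : (∑ i ∈ Finset.range (m + 1), c i) = 1)
    (hmin : ∀ d : ℕ → ℝ, (∑ i ∈ Finset.range (m + 1), d i) = 1 →
        ‖∑ i ∈ Finset.range (m + 1), c i • f (y i)‖ ≤
          ‖∑ i ∈ Finset.range (m + 1), d i • f (y i)‖) :
    m ≤ p ∧
    (∀ i ≤ m, |c i| ≤ (1 + ((m : ℝ) + 1) * 2 ^ (m + 1)) * (1 + ((τ * (1 - μ)) ^ m)⁻¹)) ∧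
    ∑ i ∈ Finset.range (m + 1), c i • g (y i) ∈ U ∧
    ‖f (∑ i ∈ Finset.range (m + 1), c i • g (y i))‖ ≤ μ ^ (m + 1) * ‖f (y 0)‖ ∧
    ‖f (∑ i ∈ Finset.range (m + 1), c i • g (y i))‖ ≤
      K * ‖∑ i ∈ Finset.range (m + 1), c i • f (y i)‖ +
        Γ * (τ ^ (2 * m))⁻¹ * ‖f (y 0)‖ * ‖f (y 0)‖ := by
  have hμ0 : 0 < μ := hK0.trans hKμ
  have hμ' : 0 < 1 - μ := by linarith
  have hrp : 0 < ‖f (y 0)‖ := norm_pos_iff.2 hy0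
  have single : ∀ j ≤ m, ‖∑ i ∈ Finset.range (m + 1), c i • f (y i)‖ ≤ ‖f (y j)‖ := by
    intro j hj
    have hjm : j ∈ Finset.range (m + 1) := Finset.mem_range.2 (by omega)
    have h := hmin (fun i => if i = j then 1 else 0) (by
      rw [Finset.sum_ite_eq' _ j]; simp [hj])
    have e : ∑ i ∈ Finset.range (m + 1), (if i = j then (1:ℝ) else 0) • f (y i) = f (y j) := by
      simp only [ite_smul, one_smul, zero_smul]
      rw [Finset.sum_ite_eq' _ j]; simp [hj]
    rw [e] at h; exact h
  obtain ⟨hs, hcb⟩ := ap_cbound τ μ h0 h1 hμ0 hμ1 (fun i => f (y i)) c m hy0 hr ht hc1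
    (single 0 (Nat.zero_le m))
  have hmp : m ≤ p := by
    refine ap_card τ h0 h1 (fun j => f (y j) - f (y 0)) m ht ?_
    intro i hi
    have := hs i hi
    rw [← norm_pos_iff]
    have h3 : 0 < (1 - μ) * ‖f (y 0)‖ := by positivity
    exact h3.trans_le this
  have hinv : 1 ≤ (τ ^ m)⁻¹ := (one_le_inv₀ (by positivity)).2 (pow_le_one₀ h0.le h1.le)
  have hmpR : (m : ℝ) ≤ p := by exact_mod_cast hmp
  set H := 1 + (p : ℝ) * 2 ^ (p + 1) * (1 - μ)⁻¹ with hH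
  have hH1 : 1 ≤ H := by
    have : 0 ≤ (p : ℝ) * 2 ^ (p + 1) * (1 - μ)⁻¹ := by positivity
    linarith
  have hcD : ∀ i ≤ m, |c i| ≤ H * (τ ^ m)⁻¹ := by
    intro i hi
    refine (hcb i hi).trans ?_
    have h2 : (2:ℝ) ^ (m + 1) ≤ 2 ^ (p + 1) := pow_le_pow_right₀ (by norm_num) (by omega)
    have h3 : (m : ℝ) * 2 ^ (m + 1) * ((τ ^ m)⁻¹ * (1 - μ)⁻¹) ≤
      p * 2 ^ (p + 1) * ((τ ^ m)⁻¹ * (1 - μ)⁻¹) := by gcongr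
    have e : H * (τ ^ m)⁻¹ = (τ ^ m)⁻¹ + p * 2 ^ (p + 1) * ((τ ^ m)⁻¹ * (1 - μ)⁻¹) := by
      rw [hH]; ring
    linarith
  have hD1 : 1 ≤ H * (τ ^ m)⁻¹ := one_le_mul_of_one_le_of_one_le hH1 hinv
  have hMQ : ((m : ℝ) + 1) * (H * (τ ^ m)⁻¹) ≤ Q * (τ ^ m)⁻¹ := by
    rw [hQ, mul_assoc]; gcongr
  have hQ0 : 0 < Q := by rw [hQ]; positivity
  have hfi : ∀ i ≤ m, ‖f (y i)‖ ≤ ‖f (y 0)‖ := fun i hi =>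
    (hr i hi).trans (mul_le_of_le_one_left hrp.le (pow_le_one₀ hμ0.le hμ1.le))
  have hye : ∀ i ≤ m, ‖y i - xs‖ ≤ ‖f (y 0)‖ / σ := by
    intro i hi
    rw [le_div_iff₀ hσ, mul_comm]
    exact (hσV _ (hUV (hyU i hi))).trans (hfi i hi)
  have hge : ∀ i ≤ m, ‖g (y i) - xs‖ ≤ ‖f (y 0)‖ / σ := by
    intro i hi
    rw [le_div_iff₀ hσ, mul_comm]
    have h2 := hgV _ (hyU i hi)
    refine (hσV _ h2).trans ((hK _ (hUV (hyU i hi)) h2).trans ?_)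
    exact (mul_le_of_le_one_left (norm_nonneg _) hK1.le).trans (hfi i hi)
  have hpowle : (τ ^ m)⁻¹ * τ ^ (2 * p) ≤ 1 := by
    rw [inv_mul_le_one₀ (by positivity)]
    exact pow_le_pow_of_le_one h0.le h1.le (by omega)
  have hpowle2 : (τ ^ (2 * m))⁻¹ * τ ^ (2 * p) ≤ 1 := by
    rw [inv_mul_le_one₀ (by positivity)]
    exact pow_le_pow_of_le_one h0.le h1.le (by omega)
  have hzU : ∑ i ∈ Finset.range (m + 1), c i • g (y i) ∈ U := by
    apply hδ
    rw [Metric.mem_ball, dist_eq_norm]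
    have hzx : ∑ i ∈ Finset.range (m + 1), c i • g (y i) - xs =
        ∑ i ∈ Finset.range (m + 1), c i • (g (y i) - xs) := by
      simp only [smul_sub, Finset.sum_sub_distrib, ← Finset.sum_smul, hc1, one_smul]
    rw [hzx]
    refine (ap_sum_bound c _ m _ _ (by linarith) hcD hge).trans_lt ?_
    calc ((m : ℝ) + 1) * (H * (τ ^ m)⁻¹) * (‖f (y 0)‖ / σ)
        ≤ Q * (τ ^ m)⁻¹ * (Rm * τ ^ (2 * p) / σ) := by gcongr
      _ = Q * Rm / σ * ((τ ^ m)⁻¹ * τ ^ (2 * p)) := by ring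
      _ ≤ Q * Rm / σ := mul_le_of_le_one_right (by positivity) hpowle
      _ < δ := by rw [div_lt_iff₀ hσ]; exact hR1
  have hq := ap_quad U f g xs A G K L L' (‖f (y 0)‖ / σ) (H * (τ ^ m)⁻¹) hK0 hK1 hL hL'
    hD1 hlin hTf hTg y c m hyU hye hcD hc1 hge hzU
  have hfin : ‖f (∑ i ∈ Finset.range (m + 1), c i • g (y i))‖ ≤
      K * ‖∑ i ∈ Finset.range (m + 1), c i • f (y i)‖ +
        Γ * (τ ^ (2 * m))⁻¹ * ‖f (y 0)‖ * ‖f (y 0)‖ := by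
    refine hq.trans ?_
    have h2 : (L + ‖A‖ * L') * (((m : ℝ) + 1) * (H * (τ ^ m)⁻¹)) ^ 2 * (‖f (y 0)‖ / σ) ^ 2 ≤
        (L + ‖A‖ * L') * (Q * (τ ^ m)⁻¹) ^ 2 * (‖f (y 0)‖ / σ) ^ 2 := by gcongr
    have h3 : (L + ‖A‖ * L') * (Q * (τ ^ m)⁻¹) ^ 2 * (‖f (y 0)‖ / σ) ^ 2 =
        Γ * (τ ^ (2 * m))⁻¹ * ‖f (y 0)‖ * ‖f (y 0)‖ := by
      have : τ ^ (2 * m) = (τ ^ m) ^ 2 := by rw [← pow_mul, mul_comm]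
      rw [hΓ, this]; field_simp
    linarith
  refine ⟨hmp, ?_, hzU, ?_, hfin⟩
  · intro i hi
    rcases Nat.eq_zero_or_pos m with hm0 | hm0
    · subst hm0
      have h2 := hcb i hi
      simp at h2 ⊢
      linarith
    · refine (hcb i hi).trans ?_
      have h2 : (τ ^ m)⁻¹ * (1 - μ)⁻¹ ≤ ((τ * (1 - μ)) ^ m)⁻¹ := by
        rw [mul_pow, mul_inv]
        gcongr
        calc (1 - μ) ^ m ≤ (1 - μ) ^ 1 :=
              pow_le_pow_of_le_one hμ'.le (by linarith) hm0
          _ = 1 - μ := pow_one _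
      have h3 : 0 < ((τ * (1 - μ)) ^ m)⁻¹ := by positivity
      have h4 : (m : ℝ) * 2 ^ (m + 1) * ((τ ^ m)⁻¹ * (1 - μ)⁻¹) ≤
        ((m : ℝ) + 1) * 2 ^ (m + 1) * ((τ * (1 - μ)) ^ m)⁻¹ := by
        gcongr; linarith
      have h5 : 0 < ((m : ℝ) + 1) * 2 ^ (m + 1) := by positivity
      nlinarith
  · have h2 := single m le_rfl
    have h3 := hr m le_rfl
    have hΓ0 : 0 ≤ Γ := by rw [hΓ]; positivity
    have h4 : Γ * (τ ^ (2 * m))⁻¹ * ‖f (y 0)‖ ≤ (μ - K) * μ ^ m := by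
      calc Γ * (τ ^ (2 * m))⁻¹ * ‖f (y 0)‖ ≤ Γ * (τ ^ (2 * m))⁻¹ * (Rm * τ ^ (2 * p)) := by
            gcongr
        _ = Γ * Rm * ((τ ^ (2 * m))⁻¹ * τ ^ (2 * p)) := by ring
        _ ≤ Γ * Rm := mul_le_of_le_one_right (by positivity) hpowle2
        _ ≤ (μ - K) * μ ^ p := hR2
        _ ≤ (μ - K) * μ ^ m := by
            have : μ ^ p ≤ μ ^ m := pow_le_pow_of_le_one hμ0.le hμ1.le hmp
            have : 0 ≤ μ - K := by linarith
            gcongr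
    calc _ ≤ _ := hfin
      _ ≤ K * (μ ^ m * ‖f (y 0)‖) + (μ - K) * μ ^ m * ‖f (y 0)‖ := by
          have h5 := h2.trans h3
          gcongr
      _ = _ := by ring

lemma ap_span {F : Type*} [NormedAddCommGroup F] [NormedSpace ℝ F] (t : ℕ → F) (m : ℕ) (v : F)
    (hv : v ∈ Submodule.span ℝ (t '' Set.Icc 1 m)) :
    ∃ a : ℕ → ℝ, v = ∑ i ∈ Finset.range m, a (i + 1) • t (i + 1) := by
  induction hv using Submodule.span_induction with
  | mem v hv =>
    obtain ⟨j, hj, rfl⟩ := hv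
    obtain ⟨j, rfl⟩ : ∃ j', j = j' + 1 := ⟨j - 1, by have := hj.1; omega⟩
    refine ⟨fun i => if i = j + 1 then 1 else 0, ?_⟩
    have := hj.2
    simp only [add_left_inj, ite_smul, one_smul, zero_smul]
    rw [Finset.sum_ite_eq' _ j, if_pos (Finset.mem_range.2 (by omega))]
  | zero => exact ⟨0, by simp⟩
  | add v w _ _ hv hw =>
    obtain ⟨a, rfl⟩ := hv
    obtain ⟨b, rfl⟩ := hw
    exact ⟨a + b, by simp [add_smul, Finset.sum_add_distrib]⟩
  | smul s v _ hv =>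
    obtain ⟨a, rfl⟩ := hv
    exact ⟨s • a, by simp [Finset.smul_sum, mul_smul]⟩

/-- At a restart, the minimal residual is controlled by the new residual. -/
lemma ap_restart {F : Type*} [NormedAddCommGroup F] [NormedSpace ℝ F] (τ : ℝ)
    (r : ℕ → F) (z : F) (m : ℕ) (c : ℕ → ℝ)
    (hmin : ∀ d : ℕ → ℝ, (∑ i ∈ Finset.range (m + 1), d i) = 1 →
        ‖∑ i ∈ Finset.range (m + 1), c i • r i‖ ≤ ‖∑ i ∈ Finset.range (m + 1), d i • r i‖)
    (hlt : Metric.infDist (z - r 0)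
      (Submodule.span ℝ ((fun j => r j - r 0) '' Set.Icc 1 m) : Set F) < τ * ‖z - r 0‖) :
    ‖∑ i ∈ Finset.range (m + 1), c i • r i‖ ≤ ‖z‖ + τ * ‖z - r 0‖ := by
  obtain ⟨v, hv, hd⟩ := (Metric.infDist_lt_iff ⟨0, Submodule.zero_mem _⟩).1 hlt
  obtain ⟨a, ha⟩ := ap_span _ m v hv
  rw [dist_eq_norm] at hd
  have h := hmin (fun i => if i = 0 then 1 - ∑ i ∈ Finset.range m, a (i + 1) else a i) (by
    rw [Finset.sum_range_succ']; simp)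
  have e : ∑ i ∈ Finset.range (m + 1),
      (if i = 0 then 1 - ∑ i ∈ Finset.range m, a (i + 1) else a i) • r i = r 0 + v := by
    rw [Finset.sum_range_succ', ha]
    simp only [smul_sub, Finset.sum_sub_distrib, sub_smul, one_smul, Finset.sum_smul,
      Nat.add_eq_zero_iff, one_ne_zero, and_false, if_false, if_true]
    abel
  rw [e] at h
  have h2 : r 0 + v = z - (z - r 0 - v) := by abel
  have h3 : ‖r 0 + v‖ ≤ ‖z‖ + ‖z - r 0 - v‖ := by
    rw [h2]; exact norm_sub_le _ _
  linarith

lemma ap_exists_run {n p : ℕ}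
    (f : EuclideanSpace ℝ (Fin n) → EuclideanSpace ℝ (Fin p))
    (g : EuclideanSpace ℝ (Fin n) → EuclideanSpace ℝ (Fin n)) (τ : ℝ)
    (x0 : EuclideanSpace ℝ (Fin n)) (hx0 : f x0 ≠ 0) :
    ∃ x m c, x 0 = x0 ∧ RestartRun f g τ x m c := by
  classical
  choose C hC1 hCmin using fun (r : ℕ → EuclideanSpace ℝ (Fin p)) (m : ℕ) => ap_exists_min r m
  let zf : ℕ → (ℕ → EuclideanSpace ℝ (Fin n)) → ℕ → EuclideanSpace ℝ (Fin n) := fun k h m =>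
    if f (h k) = 0 then h k else
      ∑ i ∈ Finset.range (m + 1), C (fun i => f (h (k - m + i))) m i • g (h (k - m + i))
  let mf : ℕ → (ℕ → EuclideanSpace ℝ (Fin n)) → ℕ → EuclideanSpace ℝ (Fin n) → ℕ :=
    fun k h m z =>
      if f z = 0 ∨ τ * ‖f z - f (h (k - m))‖ >
          Metric.infDist (f z - f (h (k - m)))
            (Submodule.span ℝ
              ((fun i => f (h (k - m + i)) - f (h (k - m))) '' Set.Icc 1 m) :
              Set (EuclideanSpace ℝ (Fin p))) then 0 else m + 1
  let S : ℕ → (ℕ → EuclideanSpace ℝ (Fin n)) × ℕ := fun k =>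
    Nat.rec (motive := fun _ => (ℕ → EuclideanSpace ℝ (Fin n)) × ℕ) (fun _ => x0, 0)
      (fun k s => (Function.update s.1 (k + 1) (zf k s.1 s.2),
        mf k s.1 s.2 (zf k s.1 s.2))) k
  have hS : ∀ k, S (k + 1) = (Function.update (S k).1 (k + 1) (zf k (S k).1 (S k).2),
        mf k (S k).1 (S k).2 (zf k (S k).1 (S k).2)) := fun k => rfl
  let x : ℕ → EuclideanSpace ℝ (Fin n) := fun k => (S k).1 k
  let m : ℕ → ℕ := fun k => (S k).2
  let c : ℕ → ℕ → ℝ := fun k => C (fun i => f ((S k).1 (k - m k + i))) (m k)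
  have hagree : ∀ k j, j ≤ k → (S k).1 j = x j := by
    intro k
    induction k with
    | zero => intro j hj; obtain rfl : j = 0 := by omega
              rfl
    | succ k ih =>
      intro j hj
      rcases Nat.lt_succ_iff_lt_or_eq.1 (Nat.lt_succ_of_le hj) with h | h
      · rw [hS]
        simp only
        rw [Function.update_of_ne (by omega)]
        exact ih j (by omega)
      · subst h; rfl
  have hxs : ∀ k, x (k + 1) = zf k (S k).1 (m k) := by
    intro k
    change (S (k + 1)).1 (k + 1) = _
    rw [hS]
    simp [m]
  have hms : ∀ k, m (k + 1) = mf k (S k).1 (m k) (x (k + 1)) := by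
    intro k
    rw [hxs]
  have hmle : ∀ k, m k ≤ k := by
    intro k
    induction k with
    | zero => exact le_rfl
    | succ k ih =>
      rw [hms]
      simp only [mf]
      split_ifs <;> omega
  have hh : ∀ k i, i ≤ m k → (S k).1 (k - m k + i) = x (k - m k + i) := by
    intro k i hi
    have := hmle k
    exact hagree k _ (by omega)
  have hh0 : ∀ k, (S k).1 (k - m k) = x (k - m k) := fun k => hagree k _ (by omega)
  have hk : ∀ k, (S k).1 k = x k := fun k => rfl
  have himg : ∀ k, (fun i => f ((S k).1 (k - m k + i)) - f (x (k - m k))) '' Set.Icc 1 (m k) =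
      (fun i => f (x (k - m k + i)) - f (x (k - m k))) '' Set.Icc 1 (m k) := by
    intro k
    refine Set.image_congr fun i hi => ?_
    rw [hh k i hi.2]
  have hfsum : ∀ k (d : ℕ → ℝ), ∑ i ∈ Finset.range (m k + 1), d i • f ((S k).1 (k - m k + i)) =
      ∑ i ∈ Finset.range (m k + 1), d i • f (x (k - m k + i)) := by
    intro k d
    refine Finset.sum_congr rfl fun i hi => ?_
    rw [hh k i (Nat.lt_succ_iff.1 (Finset.mem_range.1 hi))]
  have hgsum : ∀ k (d : ℕ → ℝ), ∑ i ∈ Finset.range (m k + 1), d i • g ((S k).1 (k - m k + i)) =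
      ∑ i ∈ Finset.range (m k + 1), d i • g (x (k - m k + i)) := by
    intro k d
    refine Finset.sum_congr rfl fun i hi => ?_
    rw [hh k i (Nat.lt_succ_iff.1 (Finset.mem_range.1 hi))]
  have hx1 : ∀ k, f (x k) ≠ 0 →
      x (k + 1) = ∑ i ∈ Finset.range (m k + 1), c k i • g (x (k - m k + i)) := by
    intro k hk0
    rw [hxs, ← hgsum]
    simp only [zf]
    rw [if_neg (by rw [hk]; exact hk0)]
  have hms' : ∀ k, m (k + 1) = if f (x (k + 1)) = 0 ∨
        τ * ‖f (x (k + 1)) - f (x (k - m k))‖ >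
          Metric.infDist (f (x (k + 1)) - f (x (k - m k)))
            (Submodule.span ℝ
              ((fun i => f (x (k - m k + i)) - f (x (k - m k))) '' Set.Icc 1 (m k)) :
              Set (EuclideanSpace ℝ (Fin p))) then 0 else m k + 1 := by
    intro k
    rw [hms]
    simp only [mf]
    rw [hh0, himg]
  have hcsum : ∀ k, ∑ i ∈ Finset.range (m k + 1), c k i = 1 := fun k => hC1 _ _
  refine ⟨x, m, c, rfl, rfl, fun k => ⟨?_, ?_, ?_, ?_, ?_⟩⟩
  · intro h
    rw [hxs]
    simp only [zf]
    rw [if_pos (by rw [hk]; exact h)]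
  · intro h
    rw [hms', if_pos (Or.inl h)]
  · intro h hm
    have h1 := hcsum k
    have h2 := hx1 k h
    rw [hm] at h1 h2
    simp at h1 h2
    refine ⟨?_, h1⟩
    rw [h2, h1, one_smul]
  · intro h _
    refine ⟨hcsum k, fun d hd => ?_, hx1 k h⟩
    rw [← hfsum, ← hfsum]
    exact hCmin _ _ d hd
  · intro h
    refine ⟨fun h2 => ?_, fun h2 => ?_⟩
    · rw [hms', if_pos (Or.inr h2)]
    · rw [hms', if_neg]
      rintro (h3 | h3)
      · exact h h3
      · exact absurd h2 (not_le.2 h3)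

/-- Local r-linear convergence of the restarted Anderson–Pulay acceleration
(version A, `Σ = ℝⁿ`), with the a priori bound on the extrapolation coefficients and the
residual estimate at restarts. -/
theorem stmt8 :
    ∃ C : ℕ → ℝ, (∀ j, 0 < C j) ∧
    ∀ n p : ℕ, 0 < n → 0 < p →
    ∀ (V U : Set (EuclideanSpace ℝ (Fin n)))
      (f : EuclideanSpace ℝ (Fin n) → EuclideanSpace ℝ (Fin p))
      (g : EuclideanSpace ℝ (Fin n) → EuclideanSpace ℝ (Fin n))
      (xs : EuclideanSpace ℝ (Fin n)) (K σ L L' : ℝ),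
    IsOpen V → xs ∈ V → ContDiffOn ℝ 2 f V → ContDiffOn ℝ 2 g V →
    g xs = xs → f xs = 0 →
    0 < K → K < 1 → (∀ x ∈ V, g x ∈ V → ‖f (g x)‖ ≤ K * ‖f x‖) →
    0 < σ → (∀ x ∈ V, σ * ‖x - xs‖ ≤ ‖f x‖) →
    U ∈ nhds xs → U ⊆ V → (∀ x ∈ U, g x ∈ V) →
    0 < L → 0 < L' →
    (∀ x ∈ U, ∀ y ∈ U, ‖f x - f y‖ ≤ 2 * ‖fderiv ℝ f xs‖ * ‖x - y‖) →
    (∀ x ∈ U, ∀ y ∈ U,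
      ‖f (g x) - f (g y)‖ ≤ 2 * ‖(fderiv ℝ f xs).comp (fderiv ℝ g xs)‖ * ‖x - y‖) →
    (∀ x ∈ U, ‖f x - fderiv ℝ f xs (x - xs)‖ ≤ L / 2 * ‖x - xs‖ ^ 2) →
    (∀ x ∈ U, ‖g x - xs - fderiv ℝ g xs (x - xs)‖ ≤ L' / 2 * ‖x - xs‖ ^ 2) →
    ∀ μ : ℝ, K < μ → μ < 1 →
    ∃ Rμ : ℝ, 0 < Rμ ∧ ∃ Γ : ℝ, 0 < Γ ∧
    ∀ τ : ℝ, 0 < τ → τ < 1 →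
    ∀ x0 ∈ U, 0 < ‖f x0‖ → ‖f x0‖ ≤ Rμ * τ ^ (2 * p) →
    (∃ x m c, x 0 = x0 ∧ RestartRun f g τ x m c) ∧
    ∀ (x : ℕ → EuclideanSpace ℝ (Fin n)) (m : ℕ → ℕ) (c : ℕ → ℕ → ℝ),
      x 0 = x0 → RestartRun f g τ x m c →
      (∀ k, f (x k) ≠ 0 →
        m k ≤ min k p ∧
        (∀ i ≤ m k, |c k i| ≤ C (m k) * (1 + ((τ * (1 - μ)) ^ m k)⁻¹)) ∧
        ‖f (x (k + 1))‖ ≤ μ ^ (m k + 1) * ‖f (x (k - m k))‖) ∧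
      (∀ k, ‖f (x k)‖ ≤ μ ^ k * ‖f x0‖) ∧
      (∀ k, m (k + 1) = 0 →
        (1 - K * (1 + τ)) * ‖f (x (k + 1))‖ ≤
          (K * τ + Γ * (τ ^ (2 * m k))⁻¹ * ‖f (x (k - m k))‖) * ‖f (x (k - m k))‖) := by
  refine ⟨fun j => 1 + ((j : ℝ) + 1) * 2 ^ (j + 1), fun j => by positivity, ?_⟩
  intro n p hn hp V U f g xs K σ L L' hV hxV hfC hgC hgx hfx hK0 hK1 hK hσ hσV hU hUV hgV hL hL'
    _ _ hTf hTg μ hKμ hμ1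
  have hμ0 : 0 < μ := hK0.trans hKμ
  have hμ' : 0 < 1 - μ := by linarith
  have hVn : V ∈ nhds xs := hV.mem_nhds hxV
  have hfd : HasFDerivAt f (fderiv ℝ f xs) xs :=
    ((hfC.contDiffAt hVn).differentiableAt (by norm_num)).hasFDerivAt
  have hgd : HasFDerivAt g (fderiv ℝ g xs) xs :=
    ((hgC.contDiffAt hVn).differentiableAt (by norm_num)).hasFDerivAt
  have hlin : ∀ w, ‖fderiv ℝ f xs (fderiv ℝ g xs w)‖ ≤ K * ‖fderiv ℝ f xs w‖ := by
    refine ap_lin f g xs _ _ hfd hgd hgx hfx K ?_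
    filter_upwards [hU] with y hy
    exact hK y (hUV hy) (hgV y hy)
  obtain ⟨δ, hδ0, hδ⟩ := Metric.mem_nhds_iff.1 hU
  set A := fderiv ℝ f xs with hA
  set G := fderiv ℝ g xs with hG
  obtain ⟨Q, hQ⟩ : ∃ Q : ℝ, Q = ((p : ℝ) + 1) * (1 + p * 2 ^ (p + 1) * (1 - μ)⁻¹) := ⟨_, rfl⟩
  have hQ0 : 0 < Q := by rw [hQ]; positivity
  obtain ⟨Γ, hΓ⟩ : ∃ Γ : ℝ, Γ = (L + ‖A‖ * L') * Q ^ 2 / σ ^ 2 := ⟨_, rfl⟩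
  have hΓ0 : 0 < Γ := by rw [hΓ]; positivity
  have hμK : 0 < μ - K := by linarith
  obtain ⟨Rm, hRm, hR1, hR2⟩ : ∃ Rm : ℝ, 0 < Rm ∧ Q * Rm < δ * σ ∧
      Γ * Rm ≤ (μ - K) * μ ^ p := by
    refine ⟨min (δ * σ / (2 * Q)) ((μ - K) * μ ^ p / Γ), by positivity, ?_, ?_⟩
    · calc Q * min (δ * σ / (2 * Q)) ((μ - K) * μ ^ p / Γ) ≤ Q * (δ * σ / (2 * Q)) := by
            gcongr; exact min_le_left _ _
        _ = δ * σ / 2 := by field_simp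
        _ < δ * σ := by
            have : 0 < δ * σ := by positivity
            linarith
    · calc Γ * min (δ * σ / (2 * Q)) ((μ - K) * μ ^ p / Γ) ≤ Γ * ((μ - K) * μ ^ p / Γ) := by
            gcongr; exact min_le_right _ _
        _ = (μ - K) * μ ^ p := by field_simp
  refine ⟨Rm, hRm, Γ, hΓ0, ?_⟩
  intro τ h0 h1 x0 hx0U hfx0 hfx0R
  refine ⟨ap_exists_run f g τ x0 (norm_pos_iff.1 hfx0), ?_⟩
  intro x m c hx0 hrun
  obtain ⟨hm0, hstep⟩ := hrun
  -- uniform description of a step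
  have halg : ∀ k, f (x k) ≠ 0 → (∑ i ∈ Finset.range (m k + 1), c k i) = 1 ∧
      (∀ d : ℕ → ℝ, (∑ i ∈ Finset.range (m k + 1), d i) = 1 →
        ‖∑ i ∈ Finset.range (m k + 1), c k i • f (x (k - m k + i))‖ ≤
          ‖∑ i ∈ Finset.range (m k + 1), d i • f (x (k - m k + i))‖) ∧
      x (k + 1) = ∑ i ∈ Finset.range (m k + 1), c k i • g (x (k - m k + i)) := by
    intro k hk
    obtain ⟨-, -, ha, hb, -⟩ := hstep k
    rcases Nat.eq_zero_or_pos (m k) with hm | hm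
    · obtain ⟨h2, h3⟩ := ha hk hm
      rw [hm]
      refine ⟨by simp [h3], fun d hd => ?_, by simp [h3, h2]⟩
      have hd' : d 0 = 1 := by simpa using hd
      simp [h3, hd']
    · exact hb hk hm
  have hW : ∀ k, f (x k) ≠ 0 → (f (x (k - m k)) ≠ 0 ∧ ‖f (x (k - m k))‖ ≤ μ ^ (k - m k) * ‖f x0‖ ∧
      (∀ i ≤ m k, x (k - m k + i) ∈ U) ∧
      (∀ i ≤ m k, ‖f (x (k - m k + i))‖ ≤ μ ^ i * ‖f (x (k - m k))‖) ∧
      (∀ i < m k, τ * ‖f (x (k - m k + (i + 1))) - f (x (k - m k))‖ ≤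
        Metric.infDist (f (x (k - m k + (i + 1))) - f (x (k - m k)))
          (Submodule.span ℝ ((fun j => f (x (k - m k + j)) - f (x (k - m k))) '' Set.Icc 1 i) :
            Set (EuclideanSpace ℝ (Fin p))))) →
      m k ≤ p ∧
      (∀ i ≤ m k, |c k i| ≤ (1 + ((m k : ℝ) + 1) * 2 ^ (m k + 1)) *
        (1 + ((τ * (1 - μ)) ^ m k)⁻¹)) ∧
      x (k + 1) ∈ U ∧ ‖f (x (k + 1))‖ ≤ μ ^ (m k + 1) * ‖f (x (k - m k))‖ ∧
      ‖f (x (k + 1))‖ ≤ K * ‖∑ i ∈ Finset.range (m k + 1), c k i • f (x (k - m k + i))‖ +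
        Γ * (τ ^ (2 * m k))⁻¹ * ‖f (x (k - m k))‖ * ‖f (x (k - m k))‖ := by
    rintro k hk ⟨w1, w2, w3, w4, w5⟩
    obtain ⟨a1, a2, a3⟩ := halg k hk
    have w2' : ‖f (x (k - m k))‖ ≤ Rm * τ ^ (2 * p) :=
      (w2.trans (mul_le_of_le_one_left hfx0.le (pow_le_one₀ hμ0.le hμ1.le))).trans hfx0R
    have := ap_window U V f g xs A G K σ L L' μ τ δ Rm Γ Q hK0 hK1 hK hσ hσV hUV hgV hL hL'
      hlin hTf hTg hKμ hμ1 h0 h1 hδ hRm hQ hR1 hΓ hR2 (fun i => x (k - m k + i)) (c k) (m k)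
      w3 w1 w2' w4 w5 a1 a2
    rw [a3]
    exact this
  have hinv : ∀ k, x k ∈ U ∧ ‖f (x k)‖ ≤ μ ^ k * ‖f x0‖ ∧ m k ≤ k ∧ (f (x k) ≠ 0 →
      f (x (k - m k)) ≠ 0 ∧ ‖f (x (k - m k))‖ ≤ μ ^ (k - m k) * ‖f x0‖ ∧
      (∀ i ≤ m k, x (k - m k + i) ∈ U) ∧
      (∀ i ≤ m k, ‖f (x (k - m k + i))‖ ≤ μ ^ i * ‖f (x (k - m k))‖) ∧
      (∀ i < m k, τ * ‖f (x (k - m k + (i + 1))) - f (x (k - m k))‖ ≤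
        Metric.infDist (f (x (k - m k + (i + 1))) - f (x (k - m k)))
          (Submodule.span ℝ ((fun j => f (x (k - m k + j)) - f (x (k - m k))) '' Set.Icc 1 i) :
            Set (EuclideanSpace ℝ (Fin p))))) := by
    intro k
    induction k with
    | zero =>
      rw [hm0, hx0]
      refine ⟨hx0U, by simp, le_rfl, fun h => ⟨?_, ?_, ?_, ?_, ?_⟩⟩
      · simpa [hx0] using h
      · simp [hx0]
      · intro i hi
        obtain rfl : i = 0 := by omega
        simpa [hx0] using hx0U
      · intro i hi
        obtain rfl : i = 0 := by omega
        simp [hx0]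
      · intro i hi; omega
    | succ k ih =>
      obtain ⟨i1, i2, i3, i4⟩ := ih
      obtain ⟨s1, s2, -, -, s5⟩ := hstep k
      by_cases hk : f (x k) = 0
      · have e := s1 hk
        have e0 : f (x (k + 1)) = 0 := by rw [e]; exact hk
        refine ⟨by rw [e]; exact i1, by rw [e0, norm_zero]; positivity, by rw [s2 e0]; omega,
          fun h => absurd e0 h⟩
      · obtain ⟨w1, w2, w3, w4, w5⟩ := i4 hk
        obtain ⟨-, -, v3, v4, -⟩ := hW k hk (i4 hk)
        have hb : ‖f (x (k + 1))‖ ≤ μ ^ (k + 1) * ‖f x0‖ := by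
          refine v4.trans ?_
          calc μ ^ (m k + 1) * ‖f (x (k - m k))‖ ≤
                μ ^ (m k + 1) * (μ ^ (k - m k) * ‖f x0‖) := by gcongr
            _ = μ ^ (m k + 1 + (k - m k)) * ‖f x0‖ := by rw [pow_add]; ring
            _ = _ := by congr 2; omega
        refine ⟨v3, hb, ?_, ?_⟩
        · by_cases hz : f (x (k + 1)) = 0
          · rw [s2 hz]; omega
          · obtain ⟨t1, t2⟩ := s5 hz
            rcases le_or_gt (τ * ‖f (x (k + 1)) - f (x (k - m k))‖) _ with h | h
            · rw [t2 h]; omega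
            · rw [t1 h]; omega
        · intro hz
          obtain ⟨t1, t2⟩ := s5 hz
          rcases le_or_gt (τ * ‖f (x (k + 1)) - f (x (k - m k))‖) _ with h | h
          · rw [t2 h]
            have e1 : k + 1 - (m k + 1) = k - m k := by omega
            have e2 : k - m k + (m k + 1) = k + 1 := by omega
            rw [e1]
            refine ⟨w1, w2, ?_, ?_, ?_⟩
            · intro i hi
              rcases Nat.lt_or_ge (m k) i with h3 | h3
              · obtain rfl : i = m k + 1 := by omega
                rw [e2]; exact v3
              · exact w3 i h3
            · intro i hi
              rcases Nat.lt_or_ge (m k) i with h3 | h3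
              · obtain rfl : i = m k + 1 := by omega
                rw [e2]; exact v4
              · exact w4 i h3
            · intro i hi
              rcases Nat.lt_or_ge i (m k) with h3 | h3
              · exact w5 i h3
              · obtain rfl : i = m k := by omega
                rw [e2]; exact h
          · rw [t1 h]
            refine ⟨hz, hb, ?_, ?_, ?_⟩
            · intro i hi
              obtain rfl : i = 0 := by omega
              exact v3
            · intro i hi
              obtain rfl : i = 0 := by omega
              simp
            · intro i hi; omega
  refine ⟨?_, fun k => (hinv k).2.1, ?_⟩
  · intro k hk
    obtain ⟨-, -, i3, i4⟩ := hinv k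
    obtain ⟨v1, v2, -, v4, -⟩ := hW k hk (i4 hk)
    exact ⟨le_min i3 v1, v2, v4⟩
  · intro k hmk
    by_cases hz : f (x (k + 1)) = 0
    · rw [hz, norm_zero, mul_zero]; positivity
    · obtain ⟨s1, -, -, -, s5⟩ := hstep k
      have hk : f (x k) ≠ 0 := by
        intro hk
        rw [s1 hk] at hz
        exact hz hk
      obtain ⟨-, -, -, -, v5⟩ := hW k hk ((hinv k).2.2.2 hk)
      obtain ⟨-, a2, -⟩ := halg k hk
      have hlt := lt_of_not_ge (fun h => by
        have := (s5 hz).2 h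
        omega)
      have hr := ap_restart τ (fun i => f (x (k - m k + i))) (f (x (k + 1))) (m k) (c k) a2 hlt
      simp only [add_zero] at hr
      have h3 : τ * ‖f (x (k + 1)) - f (x (k - m k))‖ ≤
          τ * (‖f (x (k + 1))‖ + ‖f (x (k - m k))‖) := by
        gcongr; exact norm_sub_le _ _
      have h4 := mul_le_mul_of_nonneg_left (hr.trans (add_le_add_right h3 _)) hK0.le
      linarith
end

section
/- In the abstract framework (case Σ = ℝⁿ), let Assumptions 1 and 2 hold and let μ be a real number with K < μ < 1. There exists a positive constant c_μ such that for every parameter δ ∈ (0, K): if x⁽⁰⁾ ∈ U satisfies 0 < ‖r⁽⁰⁾‖₂ ≤ c_μ δ² and one runs version A of the adaptive-depth Anderson–Pulay acceleration, then the sequences (x⁽ᵏ⁾) and (r⁽ᵏ⁾) are well defined and, as long as ‖r⁽ᵏ⁾‖₂ > 0: (1) m_k ≤ min(k, p); (2) ‖c⁽ᵏ⁾‖_∞ ≤ C_{m_k}(1 + (μ/(1−μ))^{m_k}), where C_{m_k} > 0 depends only on m_k; (3) ‖r⁽ᵏ⁺¹⁾‖₂ ≤ μ‖r⁽ᵏ⁾‖₂,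 so the method is locally q-linearly convergent. Moreover, if k − m_k ≥ 1, then ‖r⁽ᵏ⁾‖₂ ≤ δ‖r⁽ᵏ⁻ᵐ_k⁻¹⁾‖₂. -/
/-- A run `(x, m, c)` of version A of the adaptive-depth Anderson–Pulay acceleration
(Algorithm 4) with error function `f`, fixed-point function `g` and parameter `δ`:
`m₀ = 0`; if `m_k = 0` then `x⁽ᵏ⁺¹⁾ = g(x⁽ᵏ⁾)`; if `m_k ≥ 1` then
`x⁽ᵏ⁺¹⁾ = Σ_{i=0}^{m_k} cᵢ⁽ᵏ⁾ g(x⁽ᵏ⁻ᵐ_k⁺ⁱ⁾)`, where `c⁽ᵏ⁾` minimizes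
`‖Σ cᵢ r⁽ᵏ⁻ᵐ_k⁺ⁱ⁾‖₂` subject to `Σ cᵢ = 1`; then `m_{k+1}` is the largest `m ≤ m_k + 1`
such that `δ‖r⁽ⁱ⁾‖₂ < ‖r⁽ᵏ⁺¹⁾‖₂` for all `k+1−m ≤ i ≤ k`; with the convention that the
run freezes (`x⁽ᵏ⁺¹⁾ = x⁽ᵏ⁾`, `m = 0`) once `r⁽ᵏ⁾ = 0`. -/
def AdaptiveRun {n p : ℕ}
    (f : EuclideanSpace ℝ (Fin n) → EuclideanSpace ℝ (Fin p))
    (g : EuclideanSpace ℝ (Fin n) → EuclideanSpace ℝ (Fin n)) (δ : ℝ)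
    (x : ℕ → EuclideanSpace ℝ (Fin n)) (m : ℕ → ℕ) (c : ℕ → ℕ → ℝ) : Prop :=
  m 0 = 0 ∧
  ∀ k : ℕ,
    (f (x k) = 0 → x (k + 1) = x k) ∧
    (f (x (k + 1)) = 0 → m (k + 1) = 0) ∧
    (f (x k) ≠ 0 → m k = 0 → x (k + 1) = g (x k) ∧ c k 0 = 1) ∧
    (f (x k) ≠ 0 → 1 ≤ m k →
      (∑ i ∈ Finset.range (m k + 1), c k i) = 1 ∧
      (∀ d : ℕ → ℝ, (∑ i ∈ Finset.range (m k + 1), d i) = 1 →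
        ‖∑ i ∈ Finset.range (m k + 1), c k i • f (x (k - m k + i))‖ ≤
          ‖∑ i ∈ Finset.range (m k + 1), d i • f (x (k - m k + i))‖) ∧
      x (k + 1) = ∑ i ∈ Finset.range (m k + 1), c k i • g (x (k - m k + i))) ∧
    (f (x (k + 1)) ≠ 0 →
      m (k + 1) ≤ m k + 1 ∧
      (∀ i, k + 1 - m (k + 1) ≤ i → i ≤ k → δ * ‖f (x i)‖ < ‖f (x (k + 1))‖) ∧
      (∀ m' ≤ m k + 1,
        (∀ i, k + 1 - m' ≤ i → i ≤ k → δ * ‖f (x i)‖ < ‖f (x (k + 1))‖) →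
        m' ≤ m (k + 1)))

lemma aux_min {F : Type*} [NormedAddCommGroup F] [InnerProductSpace ℝ F] [FiniteDimensional ℝ F]
    (y : ℕ → F) (m : ℕ) : ∃ c : ℕ → ℝ, (∑ i ∈ Finset.range (m + 1), c i) = 1 ∧
      ∀ d : ℕ → ℝ, (∑ i ∈ Finset.range (m + 1), d i) = 1 →
        ‖∑ i ∈ Finset.range (m + 1), c i • y i‖ ≤ ‖∑ i ∈ Finset.range (m + 1), d i • y i‖ := by
  classical
  let T : (ℕ → ℝ) →ₗ[ℝ] F :=
    { toFun := fun d => ∑ i ∈ Finset.range (m + 1), d i • (y i - y 0)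
      map_add' := by
        intro a b
        simp [add_smul, Finset.sum_add_distrib]
      map_smul' := by
        intro a b
        simp [mul_smul, Finset.smul_sum] }
  have hT : ∀ d : ℕ → ℝ, T d = ∑ i ∈ Finset.range (m + 1), d i • (y i - y 0) := fun d => rfl
  have key : ∀ d : ℕ → ℝ, (∑ i ∈ Finset.range (m + 1), d i) = 1 →
      ∑ i ∈ Finset.range (m + 1), d i • y i = T d + y 0 := by
    intro d hd
    rw [hT]
    simp only [smul_sub, Finset.sum_sub_distrib, ← Finset.sum_smul, hd]
    simp
  obtain ⟨v, hv, hmin⟩ := Submodule.exists_norm_eq_iInf_of_complete_subspace (LinearMap.range T)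
    (LinearMap.range T).complete_of_finiteDimensional (-y 0)
  obtain ⟨d0, rfl⟩ := hv
  let c : ℕ → ℝ := fun i => if i = 0 then 1 - ∑ j ∈ Finset.range m, d0 (j + 1) else d0 i
  have hc : (∑ i ∈ Finset.range (m + 1), c i) = 1 := by
    rw [Finset.sum_range_succ']
    simp [c]
  have hTc : T c = T d0 := by
    rw [hT, hT, Finset.sum_range_succ', Finset.sum_range_succ']
    simp [c]
  refine ⟨c, hc, fun d hd => ?_⟩
  rw [key c hc, key d hd, hTc]
  have h1 : ‖-y 0 - T d0‖ ≤ ‖-y 0 - T d‖ := by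
    rw [hmin]
    exact ciInf_le (f := fun w : (LinearMap.range T) => ‖-y 0 - (w : F)‖)
      ⟨0, by rintro _ ⟨w, rfl⟩; exact norm_nonneg _⟩ ⟨T d, ⟨d, rfl⟩⟩
  have e1 : ∀ v : F, ‖-y 0 - v‖ = ‖v + y 0‖ := by
    intro v
    rw [← norm_neg]
    congr 1
    abel
  rwa [e1, e1] at h1

lemma aux_exists {n p : ℕ}
    (f : EuclideanSpace ℝ (Fin n) → EuclideanSpace ℝ (Fin p))
    (g : EuclideanSpace ℝ (Fin n) → EuclideanSpace ℝ (Fin n)) (δ : ℝ)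
    (x0 : EuclideanSpace ℝ (Fin n)) : ∃ x m c, x 0 = x0 ∧ AdaptiveRun f g δ x m c := by
  classical
  choose sel hsel1 hsel2 using
    (fun (y : ℕ → EuclideanSpace ℝ (Fin p)) (m : ℕ) => aux_min y m)
  let cc : ℕ → (ℕ → EuclideanSpace ℝ (Fin n)) → ℕ → ℕ → ℝ :=
    fun k X m => sel (fun i => f (X (k - m + i))) m
  let nx : ℕ → (ℕ → EuclideanSpace ℝ (Fin n)) → ℕ → EuclideanSpace ℝ (Fin n) := fun k X m =>
    if f (X k) = 0 then X k else ∑ i ∈ Finset.range (m + 1), cc k X m i • g (X (k - m + i))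
  let nm : ℕ → (ℕ → EuclideanSpace ℝ (Fin n)) → ℕ → ℕ := fun k X m =>
    if f (X (k + 1)) = 0 then 0 else
      Nat.findGreatest (fun m' => ∀ i, k + 1 - m' ≤ i → i ≤ k →
        δ * ‖f (X i)‖ < ‖f (X (k + 1))‖) (m + 1)
  let S : ℕ → (ℕ → EuclideanSpace ℝ (Fin n)) × ℕ := fun k => Nat.rec (fun _ => x0, 0)
    (fun k s => (Function.update s.1 (k + 1) (nx k s.1 s.2),
      nm k (Function.update s.1 (k + 1) (nx k s.1 s.2)) s.2)) k
  have hS : ∀ k, S (k + 1) = (Function.update (S k).1 (k + 1) (nx k (S k).1 (S k).2),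
      nm k (Function.update (S k).1 (k + 1) (nx k (S k).1 (S k).2)) (S k).2) := fun k => rfl
  let x : ℕ → EuclideanSpace ℝ (Fin n) := fun k => (S k).1 k
  let m : ℕ → ℕ := fun k => (S k).2
  have hx : ∀ k i, i ≤ k → (S k).1 i = x i := by
    intro k
    induction k with
    | zero => intro i hi; obtain rfl : i = 0 := by omega
              rfl
    | succ k ih =>
      intro i hi
      rcases Nat.lt_or_ge i (k + 1) with h | h
      · rw [hS]
        simp only
        rw [Function.update_of_ne (by omega)]
        exact ih i (by omega)
      · obtain rfl : i = k + 1 := by omega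
        rfl
  have hmk : ∀ k, m k ≤ k := by
    intro k
    induction k with
    | zero => exact le_rfl
    | succ k ih =>
      have : m (k + 1) = nm k (S (k + 1)).1 (m k) := rfl
      rw [this]
      simp only [nm]
      split_ifs
      · omega
      · exact (Nat.findGreatest_le _).trans (by omega)
  let c : ℕ → ℕ → ℝ := fun k => sel (fun i => f (x (k - m k + i))) (m k)
  have hxs : ∀ k, x (k + 1) = if f (x k) = 0 then x k else
      ∑ i ∈ Finset.range (m k + 1), cc k (S k).1 (m k) i • g ((S k).1 (k - m k + i)) := by
    intro k
    have : x (k + 1) = nx k (S k).1 (m k) := by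
      change (S (k + 1)).1 (k + 1) = _
      rw [hS]
      simp [m]
    rw [this]
  have hpost : ∀ k, f (x k) ≠ 0 → x (k + 1) = ∑ i ∈ Finset.range (m k + 1),
      (cc k (S k).1 (m k)) i • g (x (k - m k + i)) := by
    intro k hk
    rw [hxs, if_neg hk]
    refine Finset.sum_congr rfl fun i hi => ?_
    rw [hx k _ (by have := hmk k; have := Finset.mem_range.1 hi; omega)]
  have hmm : ∀ k, m (k + 1) = if f (x (k + 1)) = 0 then 0 else
      Nat.findGreatest (fun m' => ∀ i, k + 1 - m' ≤ i → i ≤ k →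
        δ * ‖f (x i)‖ < ‖f (x (k + 1))‖) (m k + 1) := by
    intro k
    have : m (k + 1) = nm k (S (k + 1)).1 (m k) := rfl
    rw [this]
    simp only [nm]
    rw [hx (k + 1) (k + 1) le_rfl]
    congr 1
    congr 1
    funext m'
    apply propext
    constructor
    · intro h i h1 h2
      rw [← hx (k + 1) i (by omega)]; exact h i h1 h2
    · intro h i h1 h2
      rw [hx (k + 1) i (by omega)]; exact h i h1 h2
  refine ⟨x, m, fun k => cc k (S k).1 (m k), rfl, rfl, fun k => ⟨?_, ?_, ?_, ?_, ?_⟩⟩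
  · intro h
    rw [hxs, if_pos h]
  · intro h
    rw [hmm, if_pos h]
  · intro h h0
    have h1 := hpost k h
    have h2 := hsel1 (fun i => f ((S k).1 (k - m k + i))) (m k)
    have h3 : ∑ i ∈ Finset.range (m k + 1), cc k (S k).1 (m k) i = 1 := h2
    change _ ∧ cc k (S k).1 (m k) 0 = 1
    rw [h0] at h1 h3 ⊢
    simp only [zero_add, Finset.sum_range_one, Nat.sub_zero, add_zero] at h1 h3
    refine ⟨?_, h3⟩
    rw [h1, h3, one_smul]
  · intro h h0
    refine ⟨hsel1 _ _, ?_, hpost k h⟩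
    intro d hd
    have h2 := hsel2 (fun i => f ((S k).1 (k - m k + i))) (m k) d hd
    have h3 : ∀ e : ℕ → ℝ, ∑ i ∈ Finset.range (m k + 1), e i • f ((S k).1 (k - m k + i)) =
        ∑ i ∈ Finset.range (m k + 1), e i • f (x (k - m k + i)) := by
      intro e
      refine Finset.sum_congr rfl fun i hi => ?_
      rw [hx k _ (by have := hmk k; have := Finset.mem_range.1 hi; omega)]
    simp only [h3] at h2
    exact h2
  · intro h
    rw [hmm, if_neg h]
    refine ⟨Nat.findGreatest_le _, ?_, ?_⟩
    · exact Nat.findGreatest_spec (P := fun m' => ∀ i, k + 1 - m' ≤ i → i ≤ k →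
        δ * ‖f (x i)‖ < ‖f (x (k + 1))‖) (Nat.zero_le _) (by intro i h1 h2; omega)
    · intro m' h1 h2
      exact Nat.le_findGreatest h1 h2

/-- Coefficient bound. -/
lemma aux_coef {F : Type*} [NormedAddCommGroup F] [NormedSpace ℝ F] (y : ℕ → F) (m : ℕ)
    (μ : ℝ) (hμ0 : 0 < μ) (hμ1 : μ < 1)
    (hy : ∀ j ≤ m, y j ≠ 0) (hdec : ∀ j < m, ‖y (j + 1)‖ ≤ ‖y j‖)
    (H : ∀ j, 1 ≤ j → j ≤ m → ∀ d : ℕ → ℝ,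
      |∑ i ∈ Finset.range j, d i| * ‖y j‖ ≤ μ * ‖∑ i ∈ Finset.range j, d i • y i‖)
    (c : ℕ → ℝ) (hc : ∑ i ∈ Finset.range (m + 1), c i = 1)
    (hcn : ‖∑ i ∈ Finset.range (m + 1), c i • y i‖ ≤ ‖y m‖) :
    ∀ i ≤ m, |c i| ≤ (2 * 4 ^ m) * (1 + (μ / (1 - μ)) ^ m) := by
  set t := μ / (1 - μ) with ht
  have h1μ : 0 < 1 - μ := by linarith
  have ht0 : 0 < t := div_pos hμ0 h1μ
  have htμ : t * (1 - μ) = μ := by rw [ht]; field_simp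
  set q := 2 * (1 + t) with hq
  have hq1 : 1 ≤ q := by rw [hq]; linarith
  have key : ∀ l ≤ m, ‖∑ i ∈ Finset.range (m + 1 - l), c i • y i‖ ≤ q ^ l * ‖y (m - l)‖ ∧
      |∑ i ∈ Finset.range (m + 1 - l), c i| ≤ q ^ l := by
    intro l
    induction l with
    | zero => intro _; simp [hc, hcn]
    | succ l ih =>
      intro hl
      obtain ⟨h1, h2⟩ := ih (by omega)
      obtain ⟨j, hj⟩ : ∃ j, m = l + (j + 1) := ⟨m - l - 1, by omega⟩
      have e1 : m + 1 - l = j + 2 := by omega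
      have e2 : m - l = j + 1 := by omega
      have e3 : m + 1 - (l + 1) = j + 1 := by omega
      have e4 : m - (l + 1) = j := by omega
      rw [e1, e2] at h1
      rw [e1] at h2
      rw [e3, e4]
      have hH := H (j + 1) (by omega) (by omega) c
      rw [show j + 2 = (j + 1) + 1 from rfl, Finset.sum_range_succ] at h1 h2
      set P := ∑ i ∈ Finset.range (j + 1), c i • y i
      set γ := ∑ i ∈ Finset.range (j + 1), c i
      have hd := hdec j (by omega)
      have hy0 : 0 < ‖y (j + 1)‖ := norm_pos_iff.2 (hy _ (by omega))
      set Y := ‖y (j + 1)‖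
      set Q := q ^ l
      have hQ : 0 < Q := by positivity
      have hPb : ‖P‖ ≤ Q * Y + Q * Y + |γ| * Y := by
        have : P = (P + c (j + 1) • y (j + 1)) - (γ + c (j + 1)) • y (j + 1)
            + γ • y (j + 1) := by
          rw [add_smul]; abel
        calc ‖P‖ = ‖(P + c (j + 1) • y (j + 1)) - (γ + c (j + 1)) • y (j + 1)
            + γ • y (j + 1)‖ := by rw [← this]
          _ ≤ ‖P + c (j + 1) • y (j + 1)‖ + ‖(γ + c (j + 1)) • y (j + 1)‖
            + ‖γ • y (j + 1)‖ := (norm_add_le _ _).trans (by gcongr; exact norm_sub_le _ _)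
          _ ≤ _ := by
            rw [norm_smul, norm_smul, Real.norm_eq_abs, Real.norm_eq_abs]
            gcongr
      have hg : |γ| ≤ 2 * Q * t := by
        have h3 : |γ| * Y * (1 - μ) ≤ (2 * Q * Y) * μ := by nlinarith
        have h4 : (|γ| * (Y * (1 - μ))) ≤ (2 * Q * t) * (Y * (1 - μ)) := by
          have e5 : (2 * Q * t) * (Y * (1 - μ)) = 2 * Q * Y * (t * (1 - μ)) := by ring
          rw [e5, htμ]
          linarith
        exact le_of_mul_le_mul_right h4 (by positivity)
      have hqq : q ^ (l + 1) = 2 * Q + 2 * Q * t := by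
        rw [pow_succ, hq]; ring
      rw [hqq]
      refine ⟨?_, by linarith⟩
      calc ‖P‖ ≤ Q * Y + Q * Y + |γ| * Y := hPb
        _ ≤ Q * Y + Q * Y + (2 * Q * t) * Y := by gcongr
        _ = (2 * Q + 2 * Q * t) * Y := by ring
        _ ≤ _ := by gcongr
  have hγ : ∀ j ≤ m + 1, |∑ i ∈ Finset.range j, c i| ≤ q ^ m := by
    intro j hj
    rcases Nat.eq_zero_or_pos j with rfl | h0
    · simp; positivity
    · have := (key (m + 1 - j) (by omega)).2
      rw [show m + 1 - (m + 1 - j) = j by omega] at this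
      exact this.trans (pow_le_pow_right₀ hq1 (by omega))
  intro i hi
  have h1 := hγ i (by omega)
  have h2 := hγ (i + 1) (by omega)
  rw [Finset.sum_range_succ] at h2
  have h3 : |c i| ≤ 2 * q ^ m := by
    rw [abs_le] at *
    constructor <;> linarith [h1.1, h1.2, h2.1, h2.2]
  have h4 : (1 + t) ^ m ≤ 2 ^ m * (1 + t ^ m) := by
    have := add_pow_le (zero_le_one (α := ℝ)) ht0.le m
    rw [one_pow] at this
    refine this.trans ?_
    gcongr
    · norm_num
    · omega
  calc |c i| ≤ 2 * q ^ m := h3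
    _ = 2 * (2 ^ m * (1 + t) ^ m) := by rw [hq, mul_pow]
    _ ≤ 2 * (2 ^ m * (2 ^ m * (1 + t ^ m))) := by gcongr
    _ = _ := by
      rw [show (4 : ℝ) = 2 * 2 by norm_num, mul_pow]; ring

lemma aux_depth {p : ℕ} (y : ℕ → EuclideanSpace ℝ (Fin p)) (m : ℕ)
    (μ : ℝ) (hμ1 : μ < 1) (hy : ∀ j ≤ m, y j ≠ 0)
    (H : ∀ j, 1 ≤ j → j ≤ m → ∀ d : ℕ → ℝ,
      |∑ i ∈ Finset.range j, d i| * ‖y j‖ ≤ μ * ‖∑ i ∈ Finset.range j, d i • y i‖) :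
    m ≤ p := by
  classical
  have hli : LinearIndependent ℝ (fun i : Fin (m + 1) => ((y i, 1) : EuclideanSpace ℝ (Fin p) × ℝ)) := by
    rw [Fintype.linearIndependent_iff]
    intro d hd
    let e : ℕ → ℝ := fun i => if h : i < m + 1 then d ⟨i, h⟩ else 0
    have he : ∀ i : Fin (m + 1), d i = e i := by
      intro i
      simp only [e]
      rw [dif_pos i.2]
    have h1 : ∑ i ∈ Finset.range (m + 1), e i • y i = 0 := by
      have := congrArg Prod.fst hd
      rw [Finset.sum_range]
      simpa [Prod.fst_sum, he] using this
    have h2 : ∑ i ∈ Finset.range (m + 1), e i = 0 := by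
      have := congrArg Prod.snd hd
      rw [Finset.sum_range]
      simpa [Prod.snd_sum, he] using this
    have key : ∀ l ≤ m, ∑ i ∈ Finset.range (m + 1 - l), e i • y i = 0 ∧
        ∑ i ∈ Finset.range (m + 1 - l), e i = 0 := by
      intro l
      induction l with
      | zero => intro _; exact ⟨h1, h2⟩
      | succ l ih =>
        intro hl
        obtain ⟨a1, a2⟩ := ih (by omega)
        obtain ⟨j, hj⟩ : ∃ j, m = l + (j + 1) := ⟨m - l - 1, by omega⟩
        have e1 : m + 1 - l = (j + 1) + 1 := by omega
        have e3 : m + 1 - (l + 1) = j + 1 := by omega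
        rw [e1, Finset.sum_range_succ] at a1 a2
        rw [e3]
        have hH := H (j + 1) (by omega) (by omega) e
        rw [eq_neg_of_add_eq_zero_left a1, eq_neg_of_add_eq_zero_left a2, abs_neg, norm_neg,
          norm_smul, Real.norm_eq_abs] at hH
        have hy0 : 0 < ‖y (j + 1)‖ := norm_pos_iff.2 (hy _ (by omega))
        have h0 : e (j + 1) = 0 := by
          by_contra hne
          have : 0 < |e (j + 1)| * ‖y (j + 1)‖ := by positivity
          nlinarith
        rw [h0] at a1 a2
        simp only [zero_smul, add_zero] at a1 a2
        exact ⟨a1, a2⟩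
    have key2 : ∀ j ≤ m + 1, ∑ i ∈ Finset.range j, e i = 0 := by
      intro j hj
      rcases Nat.eq_zero_or_pos j with rfl | h0
      · simp
      · have := (key (m + 1 - j) (by omega)).2
        rwa [show m + 1 - (m + 1 - j) = j by omega] at this
    intro i
    rw [he]
    have a1 := key2 i (by omega)
    have a2 := key2 (i + 1) (by omega)
    rw [Finset.sum_range_succ, a1] at a2
    linarith
  have := hli.fintype_card_le_finrank
  simp at this
  exact this

/-- One step. -/
lemma aux_step {E F : Type*} [NormedAddCommGroup E] [NormedSpace ℝ E]
    [NormedAddCommGroup F] [NormedSpace ℝ F] (U V : Set E) (f : E → F) (g : E → E) (xs : E)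
    (A : E →L[ℝ] F) (G : E →L[ℝ] E) (K σ L L' : ℝ)
    (hK0 : 0 < K) (hK1 : K < 1) (hK : ∀ x ∈ V, g x ∈ V → ‖f (g x)‖ ≤ K * ‖f x‖)
    (hσ : 0 < σ) (hσf : ∀ x ∈ V, σ * ‖x - xs‖ ≤ ‖f x‖)
    (hUV : U ⊆ V) (hgU : ∀ x ∈ U, g x ∈ V) (hL : 0 < L) (hL' : 0 < L')
    (hlip : ∀ x ∈ U, ∀ y ∈ U, ‖f x - f y‖ ≤ 2 * ‖A‖ * ‖x - y‖)
    (htf : ∀ x ∈ U, ‖f x - A (x - xs)‖ ≤ L / 2 * ‖x - xs‖ ^ 2)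
    (htg : ∀ x ∈ U, ‖g x - xs - G (x - xs)‖ ≤ L' / 2 * ‖x - xs‖ ^ 2)
    (N R : ℝ) (hN : 1 ≤ N) (ha1 : N * (R / σ) ≤ 1)
    (hball : ∀ z, ‖z - xs‖ ≤ (1 + ‖G‖ + L') * (N * (R / σ)) → z ∈ U)
    (M : ℕ) (z : ℕ → E) (c : ℕ → ℝ) (hR0 : 0 ≤ R)
    (hz : ∀ i < M, z i ∈ U) (hzR : ∀ i < M, ‖f (z i)‖ ≤ R)
    (hc : ∑ i ∈ Finset.range M, c i = 1) (hcN : ∑ i ∈ Finset.range M, |c i| ≤ N) :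
    (∑ i ∈ Finset.range M, c i • g (z i)) ∈ U ∧
    ‖f (∑ i ∈ Finset.range M, c i • g (z i))‖ ≤
      K * ‖∑ i ∈ Finset.range M, c i • f (z i)‖ + ((L + 2 * ‖A‖ * L') * N ^ 2 / σ ^ 2) * R ^ 2 := by
  set b := R / σ with hb
  have hb0 : 0 ≤ b := by positivity
  set a := N * b with ha
  have ha0 : 0 ≤ a := by positivity
  have hba : b ≤ a := by rw [ha]; nlinarith
  have hzb : ∀ i < M, ‖z i - xs‖ ≤ b := by
    intro i hi
    rw [hb, le_div_iff₀ hσ]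
    have := hσf _ (hUV (hz i hi))
    linarith [hzR i hi]
  have hgen : ∀ {W : Type _} [NormedAddCommGroup W] [NormedSpace ℝ W] (w : ℕ → W) (B : ℝ),
      (∀ i < M, ‖w i‖ ≤ B) → 0 ≤ B → ‖∑ i ∈ Finset.range M, c i • w i‖ ≤ N * B := by
    intro W _ _ w B hw hB
    calc ‖∑ i ∈ Finset.range M, c i • w i‖ ≤ ∑ i ∈ Finset.range M, ‖c i • w i‖ := norm_sum_le _ _
      _ ≤ ∑ i ∈ Finset.range M, |c i| * B := by
        refine Finset.sum_le_sum fun i hi => ?_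
        rw [norm_smul, Real.norm_eq_abs]
        exact mul_le_mul_of_nonneg_left (hw i (Finset.mem_range.1 hi)) (abs_nonneg _)
      _ = (∑ i ∈ Finset.range M, |c i|) * B := by rw [Finset.sum_mul]
      _ ≤ N * B := by gcongr
  have hgenF : ∀ (w : ℕ → F) (B : ℝ),
      (∀ i < M, ‖w i‖ ≤ B) → 0 ≤ B → ‖∑ i ∈ Finset.range M, c i • w i‖ ≤ N * B := by
    intro w B hw hB
    calc ‖∑ i ∈ Finset.range M, c i • w i‖ ≤ ∑ i ∈ Finset.range M, ‖c i • w i‖ := norm_sum_le _ _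
      _ ≤ ∑ i ∈ Finset.range M, |c i| * B := by
        refine Finset.sum_le_sum fun i hi => ?_
        rw [norm_smul, Real.norm_eq_abs]
        exact mul_le_mul_of_nonneg_left (hw i (Finset.mem_range.1 hi)) (abs_nonneg _)
      _ = (∑ i ∈ Finset.range M, |c i|) * B := by rw [Finset.sum_mul]
      _ ≤ N * B := by gcongr
  set xt := ∑ i ∈ Finset.range M, c i • z i with hxt
  set xn := ∑ i ∈ Finset.range M, c i • g (z i) with hxn
  have hxt' : xt - xs = ∑ i ∈ Finset.range M, c i • (z i - xs) := by
    simp only [smul_sub, Finset.sum_sub_distrib, ← Finset.sum_smul, hc, one_smul, hxt]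
  have hxn' : xn - xs = ∑ i ∈ Finset.range M, c i • (g (z i) - xs) := by
    simp only [smul_sub, Finset.sum_sub_distrib, ← Finset.sum_smul, hc, one_smul, hxn]
  have hxta : ‖xt - xs‖ ≤ a := by rw [hxt']; exact hgen _ _ hzb hb0
  have hG0 := norm_nonneg G
  have hA0 := norm_nonneg A
  have hxtU : xt ∈ U := hball _ (by nlinarith)
  have hgb : ∀ w ∈ U, ∀ r, ‖w - xs‖ ≤ r → r ≤ 1 → ‖g w - xs‖ ≤ (1 + ‖G‖ + L') * r := by
    intro w hw r hr hr1
    have h1 : ‖g w - xs‖ ≤ ‖g w - xs - G (w - xs)‖ + ‖G (w - xs)‖ := by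
      have := norm_add_le (g w - xs - G (w - xs)) (G (w - xs))
      rwa [sub_add_cancel] at this
    have h2 := htg w hw
    have h3 := G.le_opNorm (w - xs)
    have h4 := norm_nonneg (w - xs)
    have h5 : ‖w - xs‖ ^ 2 ≤ r := by nlinarith
    have h6 : ‖G‖ * ‖w - xs‖ ≤ ‖G‖ * r := by gcongr
    have h7 : L' / 2 * ‖w - xs‖ ^ 2 ≤ L' / 2 * r := by gcongr
    nlinarith
  have hgxtU : g xt ∈ U := hball _ (hgb xt hxtU a hxta ha1)
  have hxnU : xn ∈ U := by
    apply hball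
    rw [hxn']
    refine (hgen _ ((1 + ‖G‖ + L') * b)
      (fun i hi => hgb _ (hz i hi) b (hzb i hi) (hba.trans ha1)) (by positivity)).trans ?_
    rw [ha]; apply le_of_eq; ring
  refine ⟨hxnU, ?_⟩
  have hsq : ∀ C : ℝ, 0 < C → C / 2 * a ^ 2 + N * (C / 2 * b ^ 2) ≤ C * (N ^ 2 * b ^ 2) := by
    intro C hC
    have : N * b ^ 2 ≤ N ^ 2 * b ^ 2 := by
      have : 0 ≤ b ^ 2 := by positivity
      gcongr
      nlinarith
    rw [ha, mul_pow]
    nlinarith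
  have hf1 : ‖f xt - ∑ i ∈ Finset.range M, c i • f (z i)‖ ≤ L * (N ^ 2 * b ^ 2) := by
    have e : f xt - ∑ i ∈ Finset.range M, c i • f (z i) =
        (f xt - A (xt - xs)) - ∑ i ∈ Finset.range M, c i • (f (z i) - A (z i - xs)) := by
      rw [hxt', map_sum]
      simp only [map_smul, map_sub, smul_sub, Finset.sum_sub_distrib]
      abel
    rw [e]
    refine (norm_sub_le _ _).trans (le_trans (add_le_add ?_ ?_) (hsq L hL))
    · refine (htf _ hxtU).trans ?_
      gcongr
    · refine hgenF _ _ (fun i hi => (htf _ (hz i hi)).trans ?_) (by positivity)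
      have := hzb i hi
      gcongr
  have hg1 : ‖xn - g xt‖ ≤ L' * (N ^ 2 * b ^ 2) := by
    have e : xn - g xt =
        (∑ i ∈ Finset.range M, c i • (g (z i) - xs - G (z i - xs))) - (g xt - xs - G (xt - xs)) := by
      have e1 : xn - g xt = (xn - xs) - (g xt - xs) := by abel
      rw [e1, hxn', hxt', map_sum]
      simp only [map_smul, map_sub, smul_sub, Finset.sum_sub_distrib]
      abel
    rw [e]
    refine (norm_sub_le _ _).trans (le_trans ?_ (hsq L' hL'))
    rw [add_comm]
    refine add_le_add ?_ ?_
    · refine (htg _ hxtU).trans ?_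
      gcongr
    · refine hgen _ _ (fun i hi => (htg _ (hz i hi)).trans ?_) (by positivity)
      have := hzb i hi
      gcongr
  have h1 := hlip _ hxnU _ hgxtU
  have h2 := hK xt (hUV hxtU) (hgU _ hxtU)
  have h3 : ‖f xn‖ ≤ ‖f xn - f (g xt)‖ + ‖f (g xt)‖ := by
    have := norm_add_le (f xn - f (g xt)) (f (g xt))
    rwa [sub_add_cancel] at this
  have h4 : ‖f xt‖ ≤ ‖f xt - ∑ i ∈ Finset.range M, c i • f (z i)‖
      + ‖∑ i ∈ Finset.range M, c i • f (z i)‖ := by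
    have := norm_add_le (f xt - ∑ i ∈ Finset.range M, c i • f (z i))
      (∑ i ∈ Finset.range M, c i • f (z i))
    rwa [sub_add_cancel] at this
  have h5 : 2 * ‖A‖ * ‖xn - g xt‖ ≤ 2 * ‖A‖ * (L' * (N ^ 2 * b ^ 2)) := by gcongr
  have h6 : K * ‖f xt‖ ≤ K * (L * (N ^ 2 * b ^ 2)) + K * ‖∑ i ∈ Finset.range M, c i • f (z i)‖ := by
    rw [← mul_add]
    gcongr
    linarith
  have h7 : K * (L * (N ^ 2 * b ^ 2)) ≤ L * (N ^ 2 * b ^ 2) := by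
    have : 0 ≤ L * (N ^ 2 * b ^ 2) := by positivity
    nlinarith
  have h8 : ((L + 2 * ‖A‖ * L') * N ^ 2 / σ ^ 2) * R ^ 2 =
      L * (N ^ 2 * b ^ 2) + 2 * ‖A‖ * (L' * (N ^ 2 * b ^ 2)) := by
    rw [hb]; field_simp
  rw [h8]
  linarith

lemma aux_core {n p : ℕ} (V U : Set (EuclideanSpace ℝ (Fin n)))
    (f : EuclideanSpace ℝ (Fin n) → EuclideanSpace ℝ (Fin p))
    (g : EuclideanSpace ℝ (Fin n) → EuclideanSpace ℝ (Fin n))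
    (K μ δ N E c0 : ℝ) (hK0 : 0 < K) (hKμ : K < μ) (hμ1 : μ < 1)
    (hδ0 : 0 < δ) (hδK : δ < K) (hE : 0 ≤ E) (hc0 : 0 < c0) (hEc : E * c0 ≤ μ - K)
    (hN : ∀ m ≤ p, ((m : ℝ) + 1) * ((2 * 4 ^ m) * (1 + (μ / (1 - μ)) ^ m)) ≤ N)
    (hstep : ∀ R : ℝ, 0 ≤ R → R ≤ c0 → ∀ (M : ℕ) (z : ℕ → EuclideanSpace ℝ (Fin n)) (c : ℕ → ℝ),
      (∀ i < M, z i ∈ U) → (∀ i < M, ‖f (z i)‖ ≤ R) → ∑ i ∈ Finset.range M, c i = 1 →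
      ∑ i ∈ Finset.range M, |c i| ≤ N → (∑ i ∈ Finset.range M, c i • g (z i)) ∈ U ∧
      ‖f (∑ i ∈ Finset.range M, c i • g (z i))‖ ≤
        K * ‖∑ i ∈ Finset.range M, c i • f (z i)‖ + E * R ^ 2)
    (x : ℕ → EuclideanSpace ℝ (Fin n)) (m : ℕ → ℕ) (c : ℕ → ℕ → ℝ)
    (hx0 : x 0 ∈ U) (hr0 : ‖f (x 0)‖ ≤ c0 * δ ^ 2)
    (hrun : AdaptiveRun f g δ x m c) :
      (∀ k, f (x k) ≠ 0 →
        m k ≤ min k p ∧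
        (∀ i ≤ m k, |c k i| ≤ (2 * 4 ^ (m k)) * (1 + (μ / (1 - μ)) ^ m k)) ∧
        ‖f (x (k + 1))‖ ≤ μ * ‖f (x k)‖) ∧
      (∀ k, f (x k) ≠ 0 → 1 ≤ k - m k → ‖f (x k)‖ ≤ δ * ‖f (x (k - m k - 1))‖) := by
  obtain ⟨hm0, hrun⟩ := hrun
  have hμ0 : 0 < μ := hK0.trans hKμ
  have hδ1 : δ < 1 := by linarith
  have hEc0 : 0 ≤ E * c0 := by positivity
  have hms : ∀ k, m (k + 1) ≤ m k + 1 := by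
    intro k
    by_cases h : f (x (k + 1)) = 0
    · rw [(hrun k).2.1 h]; omega
    · exact ((hrun k).2.2.2.2 h).1
  have hmk : ∀ k, m k ≤ k := by
    intro k
    induction k with
    | zero => omega
    | succ k ih => have := hms k; omega
  have hmono : ∀ k i, i ≤ k → i - m i ≤ k - m k := by
    intro k i h
    induction k, h using Nat.le_induction with
    | base => exact le_rfl
    | succ k hk ih => have := hms k; have := hmk k; omega
  have hprev : ∀ k, f (x (k + 1)) ≠ 0 → f (x k) ≠ 0 := by
    intro k h h0
    rw [(hrun k).1 h0] at h
    exact h h0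
  -- the invariant
  let D : ℕ → Prop := fun i => 1 ≤ m (i + 1) → ∀ d : ℕ → ℝ,
    |∑ l ∈ Finset.range (m i + 1), d l| * ‖f (x (i + 1))‖ ≤
      μ * ‖∑ l ∈ Finset.range (m i + 1), d l • f (x (i - m i + l))‖
  let Good : ℕ → Prop := fun k => (∀ j ≤ k, f (x j) ≠ 0 ∧ x j ∈ U) ∧
    (∀ j < k, ‖f (x (j + 1))‖ ≤ ‖f (x j)‖ ∧ D j)
  have hmain : ∀ k, f (x k) ≠ 0 → Good k → (m k ≤ p ∧
      (∀ i ≤ m k, |c k i| ≤ (2 * 4 ^ (m k)) * (1 + (μ / (1 - μ)) ^ m k)) ∧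
      ‖f (x (k + 1))‖ ≤ μ * ‖f (x k)‖) ∧ x (k + 1) ∈ U ∧ (f (x (k + 1)) ≠ 0 → D k) := by
    intro k hk hgood
    obtain ⟨hg1, hg2⟩ := hgood
    set s := k - m k with hs
    have hmkk := hmk k
    have hdecr : ∀ i j, i ≤ j → j ≤ k → ‖f (x j)‖ ≤ ‖f (x i)‖ := by
      intro i j hij
      induction j, hij using Nat.le_induction with
      | base => intro _; exact le_rfl
      | succ j hj ih => intro h; exact ((hg2 j (by omega)).1).trans (ih (by omega))
    let y : ℕ → EuclideanSpace ℝ (Fin p) := fun j => f (x (s + j))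
    have hy : ∀ j ≤ m k, y j ≠ 0 := fun j hj => (hg1 _ (by omega)).1
    have hdec : ∀ j < m k, ‖y (j + 1)‖ ≤ ‖y j‖ := fun j hj => hdecr _ _ (by omega) (by omega)
    have hym : y (m k) = f (x k) := by
      simp only [y]; congr 2; omega
    have H : ∀ j, 1 ≤ j → j ≤ m k → ∀ d : ℕ → ℝ,
        |∑ i ∈ Finset.range j, d i| * ‖y j‖ ≤ μ * ‖∑ i ∈ Finset.range j, d i • y i‖ := by
      intro j hj1 hj2 d
      obtain ⟨i, hi⟩ : ∃ i, s + j = i + 1 := ⟨s + j - 1, by omega⟩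
      have hm1 := hmono k i (by omega)
      have hm2 := hmono k (i + 1) (by omega)
      have hmi := hmk i
      obtain ⟨e, he⟩ : ∃ e, m i + 1 = e + j := ⟨m i + 1 - j, by omega⟩
      have hD := (hg2 i (by omega)).2 (by omega) (fun l => if l < e then 0 else d (l - e))
      rw [he, Finset.sum_range_add, Finset.sum_range_add] at hD
      have z1 : ∑ l ∈ Finset.range e, (if l < e then (0:ℝ) else d (l - e)) = 0 :=
        Finset.sum_eq_zero fun l hl => if_pos (Finset.mem_range.1 hl)
      have z2 : ∑ l ∈ Finset.range e, (if l < e then (0:ℝ) else d (l - e)) •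
          f (x (i - m i + l)) = 0 :=
        Finset.sum_eq_zero fun l hl => by rw [if_pos (Finset.mem_range.1 hl), zero_smul]
      rw [z1, z2, zero_add, zero_add] at hD
      have z3 : ∀ l, (if e + l < e then (0:ℝ) else d (e + l - e)) = d l := by
        intro l; rw [if_neg (by omega)]; congr 1; omega
      have z4 : ∀ l, i - m i + (e + l) = s + l := by intro l; omega
      simp only [z3, z4] at hD
      simp only [y]
      rw [hi]
      exact hD
    have hmp : m k ≤ p := aux_depth y (m k) μ hμ1 hy H
    -- properties of the coefficients
    have hcs : ∑ i ∈ Finset.range (m k + 1), c k i = 1 ∧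
        (∀ d : ℕ → ℝ, (∑ i ∈ Finset.range (m k + 1), d i) = 1 →
        ‖∑ i ∈ Finset.range (m k + 1), c k i • f (x (s + i))‖ ≤
          ‖∑ i ∈ Finset.range (m k + 1), d i • f (x (s + i))‖) ∧
        x (k + 1) = ∑ i ∈ Finset.range (m k + 1), c k i • g (x (s + i)) := by
      rcases Nat.eq_zero_or_pos (m k) with h0 | h0
      · obtain ⟨h1, h2⟩ := (hrun k).2.2.1 hk h0
        have hsk : s = k := by omega
        rw [h0, hsk]
        simp only [zero_add, Finset.sum_range_one, add_zero, h2, one_smul]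
        refine ⟨trivial, fun d hd => ?_, h1⟩
        rw [hd, one_smul]
      · exact (hrun k).2.2.2.1 hk h0
    obtain ⟨hc1, hc2, hc3⟩ := hcs
    have hcle : ‖∑ i ∈ Finset.range (m k + 1), c k i • y i‖ ≤ ‖y (m k)‖ := by
      refine (hc2 (fun i => if i = m k then 1 else 0) (by simp)).trans (le_of_eq ?_)
      simp [y]
    have hcb := aux_coef y (m k) μ hμ0 hμ1 hy hdec H (c k) hc1 hcle
    have hcN : ∑ i ∈ Finset.range (m k + 1), |c k i| ≤ N := by
      refine le_trans (Finset.sum_le_sum fun i hi =>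
        hcb i (by have := Finset.mem_range.1 hi; omega)) ?_
      rw [Finset.sum_const, Finset.card_range, nsmul_eq_mul]
      push_cast
      exact hN _ hmp
    set R := ‖f (x s)‖ with hR
    have hR0 : 0 ≤ R := norm_nonneg _
    have hRr : R ≤ c0 * δ ^ 2 := (hdecr 0 s (by omega) (by omega)).trans hr0
    have hRc : R ≤ c0 := hRr.trans (by
      have : δ ^ 2 ≤ 1 := by nlinarith
      nlinarith)
    obtain ⟨hU, hest⟩ := hstep R hR0 hRc (m k + 1) (fun i => x (s + i)) (c k)
      (fun i hi => (hg1 _ (by omega)).2) (fun i hi => hdecr _ _ (by omega) (by omega)) hc1 hcN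
    rw [← hc3] at hU hest
    have hδR : δ * R ≤ ‖f (x k)‖ := by
      rcases Nat.eq_zero_or_pos (m k) with h0 | h0
      · have hsk : s = k := by omega
        rw [hR, hsk]
        have := norm_nonneg (f (x k))
        nlinarith
      · obtain ⟨k', rfl⟩ : ∃ k', k = k' + 1 := ⟨k - 1, by omega⟩
        exact (((hrun k').2.2.2.2 hk).2.1 s (by omega) (by omega)).le
    have hR2 : R ^ 2 ≤ c0 * δ * ‖f (x k)‖ := by
      have h1 : R * R ≤ c0 * δ ^ 2 * R := mul_le_mul_of_nonneg_right hRr hR0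
      have h2 : c0 * δ * (δ * R) ≤ c0 * δ * ‖f (x k)‖ :=
        mul_le_mul_of_nonneg_left hδR (by positivity)
      nlinarith
    have herr : E * R ^ 2 ≤ E * c0 * (δ * ‖f (x k)‖) := by
      have := mul_le_mul_of_nonneg_left hR2 hE
      linarith
    set T := ‖∑ i ∈ Finset.range (m k + 1), c k i • f (x (s + i))‖ with hT
    have hTle : T ≤ ‖f (x k)‖ := by rw [← hym]; exact hcle
    have hrk : 0 < ‖f (x k)‖ := norm_pos_iff.2 hk
    refine ⟨⟨hmp, hcb, ?_⟩, hU, ?_⟩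
    · have h1 : K * T ≤ K * ‖f (x k)‖ := by gcongr
      have h2 : δ * ‖f (x k)‖ ≤ ‖f (x k)‖ := by nlinarith
      have h3 : E * c0 * (δ * ‖f (x k)‖) ≤ (μ - K) * ‖f (x k)‖ :=
        mul_le_mul hEc h2 (by positivity) (by linarith)
      have h4 : K * ‖f (x k)‖ + (μ - K) * ‖f (x k)‖ = μ * ‖f (x k)‖ := by ring
      exact hest.trans (by linarith)
    · intro hne hm1 d
      have hδk : δ * ‖f (x k)‖ < ‖f (x (k + 1))‖ :=
        ((hrun k).2.2.2.2 hne).2.1 k (by omega) le_rfl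
      set r := ‖f (x (k + 1))‖ with hr
      have h1 : E * c0 * (δ * ‖f (x k)‖) ≤ E * c0 * r :=
        mul_le_mul_of_nonneg_left hδk.le hEc0
      have h2 : r * (1 - E * c0) ≤ K * T := by linarith
      have h3 : K ≤ μ * (1 - E * c0) := by nlinarith
      have h4 : r * (1 - E * c0) ≤ (μ * T) * (1 - E * c0) := by
        have : K * T ≤ μ * (1 - E * c0) * T := mul_le_mul_of_nonneg_right h3 (norm_nonneg _)
        linarith
      have h5 : r ≤ μ * T := le_of_mul_le_mul_right h4 (by linarith)
      set S := ∑ l ∈ Finset.range (m k + 1), d l with hS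
      by_cases hS0 : S = 0
      · rw [hS0]; simp; positivity
      · have h6 := hc2 (fun i => S⁻¹ * d i) (by rw [← Finset.mul_sum, ← hS]; field_simp)
        simp only [mul_smul, ← Finset.smul_sum] at h6
        rw [norm_smul, norm_inv, Real.norm_eq_abs] at h6
        have h7 : 0 < |S| := abs_pos.2 hS0
        have h8 : |S| * T ≤ ‖∑ l ∈ Finset.range (m k + 1), d l • f (x (s + l))‖ := by
          have := mul_le_mul_of_nonneg_left h6 h7.le
          rwa [← mul_assoc, mul_inv_cancel₀ h7.ne', one_mul] at this
        calc |S| * r ≤ |S| * (μ * T) := by gcongr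
          _ = μ * (|S| * T) := by ring
          _ ≤ _ := by gcongr
  have hall : ∀ k, f (x k) ≠ 0 → Good k := by
    intro k
    induction k with
    | zero =>
      intro h
      refine ⟨fun j hj => ?_, fun j hj => by omega⟩
      obtain rfl : j = 0 := by omega
      exact ⟨h, hx0⟩
    | succ k ih =>
      intro h
      have hk := hprev k h
      have hg := ih hk
      obtain ⟨⟨-, -, h3⟩, h4, h5⟩ := hmain k hk hg
      refine ⟨fun j hj => ?_, fun j hj => ?_⟩
      · rcases Nat.lt_or_ge j (k + 1) with h' | h'
        · exact hg.1 j (by omega)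
        · obtain rfl : j = k + 1 := by omega
          exact ⟨h, h4⟩
      · rcases Nat.lt_or_ge j k with h' | h'
        · exact hg.2 j h'
        · obtain rfl : j = k := by omega
          refine ⟨h3.trans ?_, h5 h⟩
          have := norm_nonneg (f (x j))
          nlinarith
  constructor
  · intro k hk
    obtain ⟨⟨h1, h2, h3⟩, -⟩ := hmain k hk (hall k hk)
    exact ⟨le_min (hmk k) h1, h2, h3⟩
  · intro k
    induction k with
    | zero => intro _ h; omega
    | succ k ih =>
      intro hne h
      have hk := hprev k hne
      obtain ⟨h1, h2, h3⟩ := (hrun k).2.2.2.2 hne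
      have hmkk := hmk k
      rcases Nat.lt_or_ge (m k) (m (k + 1)) with h' | h'
      · have e : m (k + 1) = m k + 1 := by omega
        have := ih hk (by omega)
        rw [e, show k + 1 - (m k + 1) - 1 = k - m k - 1 by omega]
        exact (((hall (k + 1) hne).2 k (by omega)).1).trans this
      · by_contra hcon
        push Not at hcon
        have := h3 (m (k + 1) + 1) (by omega) (by
          intro i hi1 hi2
          rcases Nat.lt_or_ge i (k + 1 - m (k + 1)) with h6 | h6
          · obtain rfl : i = k + 1 - m (k + 1) - 1 := by omega
            exact hcon
          · exact h2 i h6 hi2)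
        omega

/-- Local q-linear convergence of the adaptive-depth Anderson–Pulay
acceleration (version A, `Σ = ℝⁿ`), with the a priori bound on the extrapolation
coefficients and the elimination estimate `‖r⁽ᵏ⁾‖ ≤ δ‖r⁽ᵏ⁻ᵐ_k⁻¹⁾‖` when `k − m_k ≥ 1`. -/
theorem stmt9 :
    ∃ C : ℕ → ℝ, (∀ j, 0 < C j) ∧
    ∀ n p : ℕ, 0 < n → 0 < p →
    ∀ (V U : Set (EuclideanSpace ℝ (Fin n)))
      (f : EuclideanSpace ℝ (Fin n) → EuclideanSpace ℝ (Fin p))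
      (g : EuclideanSpace ℝ (Fin n) → EuclideanSpace ℝ (Fin n))
      (xs : EuclideanSpace ℝ (Fin n)) (K σ L L' : ℝ),
    IsOpen V → xs ∈ V → ContDiffOn ℝ 2 f V → ContDiffOn ℝ 2 g V →
    g xs = xs → f xs = 0 →
    0 < K → K < 1 → (∀ x ∈ V, g x ∈ V → ‖f (g x)‖ ≤ K * ‖f x‖) →
    0 < σ → (∀ x ∈ V, σ * ‖x - xs‖ ≤ ‖f x‖) →
    U ∈ nhds xs → U ⊆ V → (∀ x ∈ U, g x ∈ V) →
    0 < L → 0 < L' →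
    (∀ x ∈ U, ∀ y ∈ U, ‖f x - f y‖ ≤ 2 * ‖fderiv ℝ f xs‖ * ‖x - y‖) →
    (∀ x ∈ U, ∀ y ∈ U,
      ‖f (g x) - f (g y)‖ ≤ 2 * ‖(fderiv ℝ f xs).comp (fderiv ℝ g xs)‖ * ‖x - y‖) →
    (∀ x ∈ U, ‖f x - fderiv ℝ f xs (x - xs)‖ ≤ L / 2 * ‖x - xs‖ ^ 2) →
    (∀ x ∈ U, ‖g x - xs - fderiv ℝ g xs (x - xs)‖ ≤ L' / 2 * ‖x - xs‖ ^ 2) →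
    ∀ μ : ℝ, K < μ → μ < 1 →
    ∃ cμ : ℝ, 0 < cμ ∧
    ∀ δ : ℝ, 0 < δ → δ < K →
    ∀ x0 ∈ U, 0 < ‖f x0‖ → ‖f x0‖ ≤ cμ * δ ^ 2 →
    (∃ x m c, x 0 = x0 ∧ AdaptiveRun f g δ x m c) ∧
    ∀ (x : ℕ → EuclideanSpace ℝ (Fin n)) (m : ℕ → ℕ) (c : ℕ → ℕ → ℝ),
      x 0 = x0 → AdaptiveRun f g δ x m c →
      (∀ k, f (x k) ≠ 0 →
        m k ≤ min k p ∧
        (∀ i ≤ m k, |c k i| ≤ C (m k) * (1 + (μ / (1 - μ)) ^ m k)) ∧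
        ‖f (x (k + 1))‖ ≤ μ * ‖f (x k)‖) ∧
      (∀ k, f (x k) ≠ 0 → 1 ≤ k - m k → ‖f (x k)‖ ≤ δ * ‖f (x (k - m k - 1))‖) := by
  
  refine ⟨fun j => 2 * 4 ^ j, fun j => by positivity, ?_⟩
  intro n p hn hp V U f g xs K σ L L' hV hxsV hfC hgC hgxs hfxs hK0 hK1 hK hσ hσf hU hUV hgU
    hL hL' hlip _ htf htg μ hKμ hμ1
  have hμ0 : 0 < μ := hK0.trans hKμ
  have h1μ : 0 < 1 - μ := by linarith
  have ht : 0 < μ / (1 - μ) := div_pos hμ0 h1μ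
  obtain ⟨ρ, hρ, hball⟩ := Metric.mem_nhds_iff.1 hU
  set A := fderiv ℝ f xs
  set G := fderiv ℝ g xs
  set N : ℝ := 1 + ∑ m ∈ Finset.range (p + 1),
    ((m : ℝ) + 1) * ((2 * 4 ^ m) * (1 + (μ / (1 - μ)) ^ m)) with hNdef
  have hN1 : 1 ≤ N := by
    rw [hNdef]
    have : 0 ≤ ∑ m ∈ Finset.range (p + 1),
      ((m : ℝ) + 1) * ((2 * 4 ^ m) * (1 + (μ / (1 - μ)) ^ m)) :=
      Finset.sum_nonneg fun m _ => by positivity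
    linarith
  have hN : ∀ m ≤ p, ((m : ℝ) + 1) * ((2 * 4 ^ m) * (1 + (μ / (1 - μ)) ^ m)) ≤ N := by
    intro m hm
    have := Finset.single_le_sum (s := Finset.range (p + 1))
      (f := fun m : ℕ => ((m : ℝ) + 1) * ((2 * 4 ^ m) * (1 + (μ / (1 - μ)) ^ m)))
      (fun i _ => by positivity) (Finset.mem_range.2 (show m < p + 1 by omega))
    linarith
  set E : ℝ := (L + 2 * ‖A‖ * L') * N ^ 2 / σ ^ 2 with hE
  have hA0 := norm_nonneg A
  have hG0 := norm_nonneg G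
  have hE0 : 0 < E := by positivity
  set B : ℝ := 1 + ‖G‖ + L' with hB
  have hB0 : 0 < B := by positivity
  set ρ₁ : ℝ := min 1 (ρ / (2 * B)) with hρ₁
  have hρ₁0 : 0 < ρ₁ := by positivity
  set c0 : ℝ := min (σ * ρ₁ / N) ((μ - K) / E) with hc0
  have hμK : 0 < μ - K := by linarith
  have hc00 : 0 < c0 := by positivity
  refine ⟨c0, hc00, ?_⟩
  intro δ hδ0 hδK x0 hx0 _ hr0
  refine ⟨aux_exists f g δ x0, ?_⟩
  intro x m c hx hrun
  subst hx
  refine aux_core V U f g K μ δ N E c0 hK0 hKμ hμ1 hδ0 hδK hE0.le hc00 ?_ hN ?_ x m c hx0 hr0 hrun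
  · have : c0 ≤ (μ - K) / E := min_le_right _ _
    rw [le_div_iff₀ hE0] at this
    linarith
  · intro R hR0 hRc M z c hz hzR hc hcN
    have hRρ : N * (R / σ) ≤ ρ₁ := by
      have h1 : R ≤ σ * ρ₁ / N := hRc.trans (min_le_left _ _)
      rw [le_div_iff₀ (by linarith)] at h1
      rw [← mul_div_assoc, div_le_iff₀ hσ]
      linarith
    refine aux_step U V f g xs A G K σ L L' hK0 hK1 hK hσ hσf hUV hgU hL hL' hlip htf htg N R hN1
      (hRρ.trans (min_le_left _ _)) ?_ M z c hR0 hz hzR hc hcN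
    intro w hw
    apply hball
    rw [Metric.mem_ball, dist_eq_norm]
    have h2 : N * (R / σ) ≤ ρ / (2 * B) := hRρ.trans (min_le_right _ _)
    have h3 : B * (N * (R / σ)) ≤ ρ / 2 := by
      rw [le_div_iff₀ (by positivity)] at h2
      linarith
    linarith
end
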